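/- arXiv:1407.8282 — 3 statements merged into one kernel-verified Lean document; each statement's English description precedes it below -/
import Mathlib

section
/- There exists a constant C_1(d) > 0 depending only on d such that every spherical t-design X_N on S^d satisfies D(X_N) ≤ C_1(d)/t, where D(X_N) is the spherical cap discrepancy of X_N. -/
open MeasureTheory
open scoped RealInnerProductSpace

/-- The normalised surface area measure `σ_d` on the unit sphere `S^d ⊂ ℝ^{d+1}`. -/
noncomputable def sphereMeasure (d : ℕ) :
    Measure (EuclideanSpace ℝ (Fin (d + 1))) :=
  (μH[(d : ℝ)] (Metric.sphere (0 : EuclideanSpace ℝ (Fin (d + 1))) 1))⁻¹ •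
    (μH[(d : ℝ)]).restrict (Metric.sphere (0 : EuclideanSpace ℝ (Fin (d + 1))) 1)

/-- A finite set `X ⊂ S^d` is a spherical `t`-design if the equal-weight average over `X`
of every polynomial of total degree at most `t` equals its integral over `S^d`. -/
def IsSphericalDesign (d t : ℕ) (X : Finset (EuclideanSpace ℝ (Fin (d + 1)))) : Prop :=
  ∀ p : MvPolynomial (Fin (d + 1)) ℝ, p.totalDegree ≤ t →
    (X.card : ℝ)⁻¹ * ∑ x ∈ X, MvPolynomial.eval (fun i => x i) p =
      ∫ y, MvPolynomial.eval (fun i => y i) p ∂(sphereMeasure d)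

section
open scoped ENNReal NNReal

noncomputable def sphG : (n : ℕ) → (Fin n → ℝ) → (Fin (n+1) → ℝ)
  | 0, _ => fun _ => 1
  | n+1, w => Fin.cons (Real.cos (w 0)) (fun i => Real.sin (w 0) * sphG n (Fin.tail w) i)

lemma sphG_abs (n : ℕ) (w : Fin n → ℝ) (i : Fin (n+1)) : |sphG n w i| ≤ 1 := by
  induction n with
  | zero => simp [sphG]
  | succ n ih =>
    refine Fin.cases ?_ (fun j => ?_) i
    · simpa [sphG] using Real.abs_cos_le_one _
    · simp only [sphG, Fin.cons_succ, abs_mul]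
      exact mul_le_one₀ (Real.abs_sin_le_one _) (abs_nonneg _) (ih _ _)

lemma sin_lip (a b : ℝ) : |Real.sin a - Real.sin b| ≤ |a - b| := by
  have := Real.lipschitzWith_sin.dist_le_mul a b
  simpa [Real.dist_eq] using this

lemma cos_lip (a b : ℝ) : |Real.cos a - Real.cos b| ≤ |a - b| := by
  have := Real.lipschitzWith_cos.dist_le_mul a b
  simpa [Real.dist_eq] using this

lemma sphG_lip (n : ℕ) (w v : Fin n → ℝ) (i : Fin (n+1)) :
    |sphG n w i - sphG n v i| ≤ n * dist w v := by
  induction n with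
  | zero => simp [sphG]
  | succ n ih =>
    have h0 : |w 0 - v 0| ≤ dist w v := by
      have := dist_le_pi_dist w v 0
      rwa [Real.dist_eq] at this
    have hd : 0 ≤ dist w v := dist_nonneg
    refine Fin.cases ?_ (fun j => ?_) i
    · simp only [sphG, Fin.cons_zero]
      have := cos_lip (w 0) (v 0)
      push_cast
      nlinarith [mul_nonneg (Nat.cast_nonneg (α := ℝ) n) hd]
    · simp only [sphG, Fin.cons_succ]
      have ht : dist (Fin.tail w) (Fin.tail v) ≤ dist w v := by
        rw [dist_pi_le_iff hd]
        intro k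
        exact dist_le_pi_dist w v k.succ
      have h1 := ih (Fin.tail w) (Fin.tail v) j
      have h2 := sin_lip (w 0) (v 0)
      have e : Real.sin (w 0) * sphG n (Fin.tail w) j - Real.sin (v 0) * sphG n (Fin.tail v) j
        = (Real.sin (w 0) - Real.sin (v 0)) * sphG n (Fin.tail w) j
          + Real.sin (v 0) * (sphG n (Fin.tail w) j - sphG n (Fin.tail v) j) := by ring
      rw [e]
      refine (abs_add_le _ _).trans ?_
      rw [abs_mul, abs_mul]
      have h3 : |Real.sin (w 0) - Real.sin (v 0)| * |sphG n (Fin.tail w) j| ≤ dist w v :=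
        (mul_le_of_le_one_right (abs_nonneg _) (sphG_abs _ _ _)).trans (h2.trans h0)
      have h4 : |Real.sin (v 0)| * |sphG n (Fin.tail w) j - sphG n (Fin.tail v) j| ≤ n * dist w v :=
        (mul_le_of_le_one_left (abs_nonneg _) (Real.abs_sin_le_one _)).trans
          (h1.trans (by gcongr))
      push_cast
      linarith

lemma sphG_surj (m : ℕ) (x : Fin (m+2) → ℝ) (hx : ∑ i, x i ^ 2 = 1) (θ : ℝ)
    (h0 : 0 ≤ θ) (hpi : θ ≤ Real.pi) (hc : Real.cos θ = x 0) :
    ∃ w : Fin (m+1) → ℝ, (w 0 = θ ∨ w 0 = -θ) ∧ (∀ i, |w i| ≤ Real.pi) ∧ sphG (m+1) w = x := by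
  have hpi0 := Real.pi_pos
  induction m generalizing θ with
  | zero =>
    have hx1 : x 1 ^ 2 = Real.sin θ ^ 2 := by
      rw [Fin.sum_univ_two] at hx
      have := Real.sin_sq_add_cos_sq θ
      rw [hc] at this; linarith
    rcases sq_eq_sq_iff_eq_or_eq_neg.1 hx1 with h | h
    · refine ⟨fun _ => θ, Or.inl rfl, fun _ => by rw [abs_of_nonneg h0]; exact hpi, ?_⟩
      funext i
      fin_cases i
      · simpa [sphG] using hc
      · have : sphG (0+1) (fun _ => θ) (Fin.succ 0) = x 1 := by
          simp only [sphG, Fin.cons_succ]; rw [h]; ring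
        exact this
    · refine ⟨fun _ => -θ, Or.inr rfl, fun _ => by rw [abs_neg, abs_of_nonneg h0]; exact hpi, ?_⟩
      funext i
      fin_cases i
      · simpa [sphG] using hc
      · have : sphG (0+1) (fun _ => -θ) (Fin.succ 0) = x 1 := by
          simp only [sphG, Fin.cons_succ]; rw [h, Real.sin_neg]; ring
        exact this
  | succ m ih =>
    have hs : ∑ i, (Fin.tail x) i ^ 2 = Real.sin θ ^ 2 := by
      rw [Fin.sum_univ_succ] at hx
      have := Real.sin_sq_add_cos_sq θ
      rw [hc] at this
      simp only [Fin.tail]; linarith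
    have key : ∃ w : Fin (m+1) → ℝ, (∀ i, |w i| ≤ Real.pi) ∧
        ∀ i, Real.sin θ * sphG (m+1) w i = Fin.tail x i := by
      by_cases hz : Real.sin θ = 0
      · refine ⟨0, fun i => by simpa using hpi0.le, fun i => ?_⟩
        rw [hz] at hs ⊢
        have := (Finset.sum_eq_zero_iff_of_nonneg (fun i _ => sq_nonneg _)).1
          (hs.trans (by norm_num)) i (Finset.mem_univ _)
        rw [zero_mul]
        exact (pow_eq_zero_iff (by norm_num)).1 this |>.symm
      · have hu : ∑ i, (Fin.tail x i / Real.sin θ) ^ 2 = 1 := by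
          simp only [div_pow]
          rw [← Finset.sum_div, hs, div_self (pow_ne_zero _ hz)]
        have hle : (Fin.tail x 0 / Real.sin θ) ^ 2 ≤ 1 := by
          rw [← hu]
          exact Finset.single_le_sum (f := fun i => (Fin.tail x i / Real.sin θ) ^ 2)
            (fun i _ => sq_nonneg _) (Finset.mem_univ 0)
        obtain ⟨hl, hr⟩ := abs_le.1 ((sq_le_one_iff_abs_le_one _).1 hle)
        obtain ⟨w, -, hw, he⟩ := ih (fun i => Fin.tail x i / Real.sin θ) hu
          (Real.arccos (Fin.tail x 0 / Real.sin θ)) (Real.arccos_nonneg _) (Real.arccos_le_pi _)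
          (Real.cos_arccos hl hr)
        refine ⟨w, hw, fun i => ?_⟩
        rw [he]; field_simp
    obtain ⟨w, hw, he⟩ := key
    refine ⟨Fin.cons θ w, Or.inl rfl, ?_, ?_⟩
    · refine Fin.cases ?_ (fun j => ?_)
      · simpa [abs_of_nonneg h0] using hpi
      · simpa using hw j
    · funext i
      refine Fin.cases ?_ (fun j => ?_) i
      · simpa [sphG] using hc
      · have := he j
        simp only [sphG, Fin.cons_succ, Fin.cons_zero, Fin.tail_cons] at this ⊢
        exact this


lemma ring_bound (m : ℕ) : ∃ K : ℝ≥0∞, K ≠ ∞ ∧ ∀ y : EuclideanSpace ℝ (Fin (m+1+1)), ‖y‖ = 1 →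
    ∀ a b : ℝ, 0 ≤ a → b ≤ Real.pi →
    μH[((m+1 : ℕ) : ℝ)] {x : EuclideanSpace ℝ (Fin (m+1+1)) | ‖x‖ = 1 ∧
      ∃ θ ∈ Set.Icc a b, Real.cos θ = ⟪x, y⟫} ≤ K * ENNReal.ofReal (b - a) := by
  have hG : LipschitzWith ((m+1 : ℕ) : ℝ≥0) (sphG (m+1)) := by
    refine LipschitzWith.of_dist_le_mul fun w v => ?_
    rw [dist_pi_le_iff (by positivity)]
    intro i
    rw [Real.dist_eq]
    simpa using sphG_lip (m+1) w v i
  have hL := (PiLp.lipschitzWith_toLp 2 (fun _ : Fin (m+1+1) => ℝ)).comp hG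
  set K0 : ℝ≥0 := (↑(Fintype.card (Fin (m+1+1))) ^ (1 / (2:ℝ≥0∞)).toReal) * ((m+1 : ℕ) : ℝ≥0) with hK0
  refine ⟨(K0 : ℝ≥0∞) ^ ((m+1 : ℕ) : ℝ) * (2 * ENNReal.ofReal (2 * Real.pi) ^ m), ?_, ?_⟩
  · refine ENNReal.mul_ne_top (ENNReal.rpow_ne_top_of_nonneg (by positivity) ENNReal.coe_ne_top) ?_
    exact ENNReal.mul_ne_top (by simp) (ENNReal.pow_ne_top ENNReal.ofReal_ne_top)
  intro y hy a b ha hb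
  obtain ⟨B, hB⟩ := Orthonormal.exists_orthonormalBasis_extension_of_card_eq (𝕜 := ℝ)
    (E := EuclideanSpace ℝ (Fin (m+1+1))) (ι := Fin (m+1+1)) (by simp) (v := fun _ => y) (s := {0})
    (by
      constructor
      · intro i; simpa using hy
      · intro i j hij; exact (hij (Subsingleton.elim i j)).elim)
  have hB0 : B 0 = y := hB 0 rfl
  have hL2 := B.repr.symm.lipschitz.comp hL
  rw [one_mul] at hL2
  set bx : Set (Fin (m+1) → ℝ) :=
    Set.Icc (Fin.cons a (fun _ => -Real.pi)) (Fin.cons b (fun _ => Real.pi)) ∪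
    Set.Icc (Fin.cons (-b) (fun _ => -Real.pi)) (Fin.cons (-a) (fun _ => Real.pi)) with hbx
  have hvol : μH[((m+1 : ℕ) : ℝ)] bx ≤ 2 * ENNReal.ofReal (2 * Real.pi) ^ m * ENNReal.ofReal (b - a) := by
    have e := hausdorffMeasure_pi_real (ι := Fin (m+1))
    rw [Fintype.card_fin] at e
    rw [e, hbx]
    refine (measure_union_le _ _).trans ?_
    rw [Real.volume_Icc_pi, Real.volume_Icc_pi, Fin.prod_univ_succ, Fin.prod_univ_succ]
    simp only [Fin.cons_zero, Fin.cons_succ, Finset.prod_const, Finset.card_univ, Fintype.card_fin]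
    rw [show Real.pi - -Real.pi = 2 * Real.pi by ring, show -a - -b = b - a by ring]
    apply le_of_eq; ring
  have hsub : {x : EuclideanSpace ℝ (Fin (m+1+1)) | ‖x‖ = 1 ∧
      ∃ θ ∈ Set.Icc a b, Real.cos θ = ⟪x, y⟫} ⊆
      (B.repr.symm ∘ (WithLp.toLp 2 ∘ sphG (m+1))) '' bx := by
    rintro x ⟨hx, θ, hθ, hc⟩
    have hsum : ∑ i, (B.repr x) i ^ 2 = 1 := by
      have : ‖B.repr x‖ = 1 := by rw [LinearIsometryEquiv.norm_map, hx]
      have h2 := EuclideanSpace.norm_sq_eq (B.repr x)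
      rw [this] at h2
      simpa using h2.symm
    obtain ⟨w, hw0, hw, he⟩ := sphG_surj m (fun i => B.repr x i) hsum θ (ha.trans hθ.1) (hθ.2.trans hb)
      (by rw [B.repr_apply_apply, hB0, hc, real_inner_comm])
    refine ⟨w, ?_, ?_⟩
    · have hw' := fun i => abs_le.1 (hw i)
      rcases hw0 with h | h
      · left
        constructor
        · refine Fin.cases ?_ (fun j => ?_)
          · simpa [h] using hθ.1
          · simpa using (hw' j.succ).1
        · refine Fin.cases ?_ (fun j => ?_)
          · simpa [h] using hθ.2
          · simpa using (hw' j.succ).2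
      · right
        constructor
        · refine Fin.cases ?_ (fun j => ?_)
          · simpa [h] using hθ.2
          · simpa using (hw' j.succ).1
        · refine Fin.cases ?_ (fun j => ?_)
          · simpa [h] using hθ.1
          · simpa using (hw' j.succ).2
    · simp only [Function.comp]
      rw [he]
      exact B.repr.symm_apply_apply x
  refine (measure_mono hsub).trans ?_
  refine (hL2.hausdorffMeasure_image_le (by positivity) bx).trans ?_
  rw [mul_assoc]
  gcongr

/-- (Unnormalised) Fejer kernel. -/
noncomputable def fej (n : ℕ) (s : ℝ) : ℝ :=
  ∑ k ∈ Finset.range n, ∑ l ∈ Finset.range n, Real.cos (((k : ℝ) - l) * s)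

lemma fej_eq (n : ℕ) (s : ℝ) : fej n s = (∑ k ∈ Finset.range n, Real.cos (k * s)) ^ 2
    + (∑ k ∈ Finset.range n, Real.sin (k * s)) ^ 2 := by
  simp only [fej, sq, Finset.sum_mul_sum, sub_mul, Real.cos_sub, Finset.sum_add_distrib]

lemma fej_nonneg (n : ℕ) (s : ℝ) : 0 ≤ fej n s := by rw [fej_eq]; positivity

lemma fej_cont (n : ℕ) : Continuous (fej n) := by unfold fej; fun_prop

lemma fej_even (n : ℕ) (s : ℝ) : fej n (-s) = fej n s := by
  simp [fej]

lemma fej_norm (n : ℕ) (s : ℝ) :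
    fej n s = ‖∑ k ∈ Finset.range n, Complex.exp (s * Complex.I) ^ k‖ ^ 2 := by
  rw [fej_eq, ← Complex.normSq_eq_norm_sq, Complex.normSq_apply]
  have h : ∀ k : ℕ, Complex.exp (s * Complex.I) ^ k
      = (Real.cos (k * s) : ℂ) + (Real.sin (k * s) : ℂ) * Complex.I := by
    intro k
    rw [← Complex.exp_nat_mul, ← mul_assoc, Complex.exp_mul_I]
    push_cast; rfl
  simp only [h, Complex.re_sum, Complex.im_sum]
  simp [sq, -Complex.ofReal_cos, -Complex.ofReal_sin]

lemma fej_le (n : ℕ) (s : ℝ) (h0 : 0 < s) (h1 : s ≤ Real.pi) : fej n s ≤ Real.pi ^ 2 * s ^ (-2 : ℤ) := by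
  rw [fej_norm]
  set z := Complex.exp (s * Complex.I) with hz
  have hg := geom_sum_mul z n
  have hz1 : ‖z‖ = 1 := Complex.norm_exp_ofReal_mul_I s
  have hn : ‖z ^ n - 1‖ ≤ 2 := by
    refine (norm_sub_le _ _).trans ?_
    rw [norm_pow, hz1]; norm_num
  have hs : 2 * s / Real.pi ≤ ‖z - 1‖ := by
    have : ‖z - 1‖ = ‖2 * Real.sin (s / 2)‖ := by
      rw [hz, mul_comm]; exact Complex.norm_exp_I_mul_ofReal_sub_one s
    rw [this]
    refine le_trans ?_ (le_abs_self _)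
    have := Real.mul_le_sin (x := s / 2) (by positivity) (by linarith)
    calc 2 * s / Real.pi = 2 * (2 / Real.pi * (s / 2)) := by ring
      _ ≤ _ := by gcongr
  have hm := congrArg norm hg
  rw [norm_mul] at hm
  have hp := Real.pi_pos
  set A := ‖∑ k ∈ Finset.range n, z ^ k‖
  have hA : A * (2 * s / Real.pi) ≤ 2 := by
    calc _ ≤ A * ‖z - 1‖ := by gcongr
      _ ≤ 2 := by rw [hm]; exact hn
  have hA2 : A ≤ Real.pi / s := by
    rw [le_div_iff₀ h0]
    have := mul_le_mul_of_nonneg_right hA hp.le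
    have e : A * (2 * s / Real.pi) * Real.pi = 2 * (A * s) := by field_simp
    linarith
  calc A ^ 2 ≤ (Real.pi / s) ^ 2 := by gcongr
    _ = _ := by rw [div_pow, zpow_neg]; rfl

lemma fej_int (n : ℕ) : ∫ s in (-Real.pi)..Real.pi, fej n s = 2 * Real.pi * n := by
  unfold fej
  rw [intervalIntegral.integral_finsetSum (fun k _ => Continuous.intervalIntegrable (by fun_prop) _ _)]
  have : ∀ k ∈ Finset.range n, ∫ s in (-Real.pi)..Real.pi,
      ∑ l ∈ Finset.range n, Real.cos (((k : ℝ) - l) * s) = 2 * Real.pi := by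
    intro k hk
    rw [intervalIntegral.integral_finsetSum
      (fun k _ => Continuous.intervalIntegrable (by fun_prop) _ _)]
    rw [Finset.sum_eq_single_of_mem k hk]
    · simp; ring
    · intro l _ hl
      have hne : (k : ℝ) - l ≠ 0 := by
        rw [sub_ne_zero]; exact_mod_cast hl.symm
      rw [intervalIntegral.integral_comp_mul_left _ hne, integral_cos]
      have h : Real.sin (((k : ℝ) - l) * Real.pi) = 0 := by
        have := Real.sin_int_mul_pi ((k : ℤ) - l)
        push_cast at this; exact this
      rw [mul_neg, Real.sin_neg, h]; simp
  rw [Finset.sum_congr rfl this]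
  simp; ring

lemma fej_tail (n : ℕ) (δ : ℝ) (h0 : 0 < δ) (h1 : δ ≤ Real.pi) :
    ∫ s in δ..Real.pi, fej n s ≤ Real.pi ^ 2 / δ := by
  have hnot : (0:ℝ) ∉ Set.uIcc δ Real.pi := by
    rw [Set.uIcc_of_le h1]; intro h; linarith [h.1]
  have hi : IntervalIntegrable (fun s : ℝ => Real.pi ^ 2 * s ^ (-2 : ℤ)) volume δ Real.pi :=
    (intervalIntegral.intervalIntegrable_zpow (Or.inr hnot)).const_mul _
  calc _ ≤ ∫ s in δ..Real.pi, Real.pi ^ 2 * s ^ (-2 : ℤ) := by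
        refine intervalIntegral.integral_mono_on h1 ((fej_cont n).intervalIntegrable _ _) hi ?_
        intro s hs
        exact fej_le n s (by linarith [hs.1]) hs.2
    _ = Real.pi ^ 2 * (δ⁻¹ - Real.pi⁻¹) := by
        rw [intervalIntegral.integral_const_mul, integral_zpow (Or.inr ⟨by norm_num, hnot⟩)]
        norm_num
        ring
    _ ≤ _ := by
        have : 0 < Real.pi⁻¹ := by positivity
        rw [div_eq_mul_inv]; gcongr; linarith

lemma fej_window (n : ℕ) (hn : 0 < n) (δ : ℝ) (hδ : δ = 4 * Real.pi / n) (h1 : δ ≤ Real.pi) :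
    3 / 4 * (2 * Real.pi * n) ≤ ∫ s in (-δ)..δ, fej n s := by
  have hp := Real.pi_pos
  have hn' : (0:ℝ) < n := by exact_mod_cast hn
  have h0 : 0 < δ := by rw [hδ]; positivity
  have hI : ∀ a b, IntervalIntegrable (fej n) volume a b := fun a b => (fej_cont n).intervalIntegrable _ _
  have e1 := intervalIntegral.integral_add_adjacent_intervals (hI (-Real.pi) (-δ)) (hI (-δ) δ)
  have e2 := intervalIntegral.integral_add_adjacent_intervals (hI (-Real.pi) δ) (hI δ Real.pi)
  have e3 : ∫ s in (-Real.pi)..(-δ), fej n s = ∫ s in δ..Real.pi, fej n s := by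
    rw [← intervalIntegral.integral_comp_neg]
    simp only [fej_even]
  have e4 := fej_tail n δ h0 h1
  have e5 := fej_int n
  have e6 : Real.pi ^ 2 / δ = Real.pi * n / 4 := by rw [hδ]; field_simp
  linarith

lemma fej_periodic (n : ℕ) : Function.Periodic (fej n) (2 * Real.pi) := by
  intro s
  unfold fej
  refine Finset.sum_congr rfl fun k _ => Finset.sum_congr rfl fun l _ => ?_
  have := Real.cos_add_int_mul_two_pi (((k : ℝ) - l) * s) ((k : ℤ) - l)
  push_cast at this
  rw [mul_add, this]

lemma fej_full (n : ℕ) (c : ℝ) :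
    ∫ τ in (0:ℝ)..Real.pi, (fej n (c - τ) + fej n (c + τ)) = 2 * Real.pi * n := by
  have hc := fej_cont n
  rw [intervalIntegral.integral_add (Continuous.intervalIntegrable (by fun_prop) _ _)
    (Continuous.intervalIntegrable (by fun_prop) _ _)]
  rw [intervalIntegral.integral_comp_sub_left, intervalIntegral.integral_comp_add_left]
  simp only [sub_zero, add_zero]
  rw [intervalIntegral.integral_add_adjacent_intervals (hc.intervalIntegrable _ _)
    (hc.intervalIntegrable _ _)]
  have := (fej_periodic n).intervalIntegral_add_eq (c - Real.pi) (-Real.pi)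
  rw [show c - Real.pi + 2 * Real.pi = c + Real.pi by ring,
    show -Real.pi + 2 * Real.pi = Real.pi by ring] at this
  rw [this, fej_int]

lemma fej_orth (t : ℕ) (F : ℝ → ℝ) (hint : IntervalIntegrable F volume 0 Real.pi)
    (horth : ∀ m : ℤ, m.natAbs ≤ t → ∫ τ in (0:ℝ)..Real.pi, Real.sin (m * τ) * F τ = 0) (c : ℝ) :
    ∫ τ in (0:ℝ)..Real.pi, (fej t (c - τ) - fej t (c + τ)) * F τ = 0 := by
  have hi : ∀ r : ℝ, IntervalIntegrable (fun τ => Real.sin (r * τ) * F τ) volume 0 Real.pi := by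
    intro r
    exact hint.continuousOn_mul (by fun_prop)
  have e : ∀ τ, (fej t (c - τ) - fej t (c + τ)) * F τ =
      ∑ k ∈ Finset.range t, ∑ l ∈ Finset.range t,
        2 * Real.sin (((k : ℝ) - l) * c) * (Real.sin (((k : ℝ) - l) * τ) * F τ) := by
    intro τ
    unfold fej
    rw [← Finset.sum_sub_distrib, Finset.sum_mul]
    refine Finset.sum_congr rfl fun k _ => ?_
    rw [← Finset.sum_sub_distrib, Finset.sum_mul]
    refine Finset.sum_congr rfl fun l _ => ?_
    rw [mul_sub, mul_add, Real.cos_sub, Real.cos_add]; ring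
  simp only [e]
  rw [intervalIntegral.integral_finsetSum]
  · refine Finset.sum_eq_zero fun k hk => ?_
    rw [intervalIntegral.integral_finsetSum]
    · refine Finset.sum_eq_zero fun l hl => ?_
      rw [intervalIntegral.integral_const_mul]
      have := horth ((k : ℤ) - l) (by
        have := Finset.mem_range.1 hk
        have := Finset.mem_range.1 hl
        omega)
      push_cast at this
      rw [this, mul_zero]
    · intro l _
      exact (hi _).const_mul _
  · intro k _
    have := IntervalIntegrable.sum (Finset.range t) (f := fun (l : ℕ) τ =>
      2 * Real.sin (((k : ℝ) - l) * c) * (Real.sin (((k : ℝ) - l) * τ) * F τ))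
      (fun l _ => (hi ((k : ℝ) - l)).const_mul _)
    simpa only [Finset.sum_fn] using this

lemma contraction (t : ℕ) (ht : 0 < t) (F : ℝ → ℝ) (C M : ℝ) (hC : 0 ≤ C)
    (hint : IntervalIntegrable F volume 0 Real.pi) (hFpi : F Real.pi ≤ 0)
    (hlip : ∀ a b, 0 ≤ a → a ≤ b → b ≤ Real.pi → F a - C * (b - a) ≤ F b)
    (horth : ∀ m : ℤ, m.natAbs ≤ t → ∫ τ in (0:ℝ)..Real.pi, Real.sin (m * τ) * F τ = 0)
    (hM : ∀ τ, 0 ≤ τ → τ ≤ Real.pi → |F τ| ≤ M) (φ : ℝ) (h0 : 0 ≤ φ) (h1 : φ ≤ Real.pi) :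
    F φ ≤ M / 3 + 2 * C * (4 * Real.pi / t) := by
  have hp := Real.pi_pos
  have ht' : (0:ℝ) < t := by exact_mod_cast ht
  obtain ⟨δ, hδ⟩ : ∃ δ : ℝ, δ = 4 * Real.pi / t := ⟨_, rfl⟩
  have hδ0 : 0 < δ := by rw [hδ]; positivity
  rw [← hδ]
  have hM0 : 0 ≤ M := (abs_nonneg _).trans (hM φ h0 h1)
  by_cases hw : Real.pi ≤ φ + 2 * δ
  · have := hlip φ Real.pi h0 h1 le_rfl
    have : C * (Real.pi - φ) ≤ C * (2 * δ) := by gcongr; linarith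
    linarith
  push Not at hw
  by_cases hv : F φ - 2 * C * δ ≤ 0
  · linarith
  push Not at hv
  set v := F φ - 2 * C * δ with hvdef
  obtain ⟨c, hc⟩ : ∃ c, c = φ + δ := ⟨_, rfl⟩
  have hcont := fej_cont t
  have hz := fej_orth t F hint horth c
  have hH := fej_full t c
  have hiG : IntervalIntegrable (fun τ => (fej t (c - τ) - fej t (c + τ)) * F τ) volume 0 Real.pi :=
    hint.continuousOn_mul (by fun_prop)
  have hiH : IntervalIntegrable (fun τ => M * (fej t (c - τ) + fej t (c + τ))) volume 0 Real.pi :=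
    Continuous.intervalIntegrable (by fun_prop) _ _
  set P := fun τ => (fej t (c - τ) - fej t (c + τ)) * F τ + M * (fej t (c - τ) + fej t (c + τ)) with hP
  have hiP : IntervalIntegrable P volume 0 Real.pi := hiG.add hiH
  have hPint : ∫ τ in (0:ℝ)..Real.pi, P τ = M * (2 * Real.pi * t) := by
    rw [hP, intervalIntegral.integral_add hiG hiH, hz, intervalIntegral.integral_const_mul, hH, zero_add]
  have hP0 : ∀ τ, 0 ≤ τ → τ ≤ Real.pi → 0 ≤ P τ := by
    intro τ a b
    obtain ⟨l, r⟩ := abs_le.1 (hM τ a b)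
    have := mul_nonneg (fej_nonneg t (c - τ)) (by linarith : 0 ≤ M + F τ)
    have := mul_nonneg (fej_nonneg t (c + τ)) (by linarith : 0 ≤ M - F τ)
    simp only [hP]; linarith
  have hsub : Set.uIcc φ (φ + 2 * δ) ⊆ Set.uIcc 0 Real.pi := by
    rw [Set.uIcc_of_le (by linarith), Set.uIcc_of_le hp.le]
    exact Set.Icc_subset_Icc h0 hw.le
  have hlow : ∫ τ in φ..(φ + 2 * δ), (v + M) * fej t (c - τ) ≤ ∫ τ in φ..(φ + 2 * δ), P τ := by
    refine intervalIntegral.integral_mono_on (by linarith)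
      (Continuous.intervalIntegrable (by fun_prop) _ _) (hiP.mono_set hsub) ?_
    intro τ hτ
    have a : 0 ≤ τ := h0.trans hτ.1
    have b : τ ≤ Real.pi := hτ.2.trans hw.le
    obtain ⟨l, r⟩ := abs_le.1 (hM τ a b)
    have h3 := hlip φ τ h0 hτ.1 b
    have h4 : C * (τ - φ) ≤ C * (2 * δ) := by gcongr; linarith [hτ.2]
    have := mul_nonneg (fej_nonneg t (c - τ)) (by linarith : 0 ≤ F τ - v)
    have := mul_nonneg (fej_nonneg t (c + τ)) (by linarith : 0 ≤ M - F τ)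
    simp only [hP]; linarith
  have hmono : ∫ τ in φ..(φ + 2 * δ), P τ ≤ ∫ τ in (0:ℝ)..Real.pi, P τ := by
    refine intervalIntegral.integral_mono_interval h0 (by linarith) hw.le ?_ hiP
    refine (ae_restrict_iff' measurableSet_Ioc).2 (Filter.Eventually.of_forall fun τ hτ => ?_)
    exact hP0 τ hτ.1.le hτ.2
  have hwin := fej_window t ht δ hδ (by linarith)
  have heq : ∫ τ in φ..(φ + 2 * δ), (v + M) * fej t (c - τ) = (v + M) * ∫ s in (-δ)..δ, fej t s := by
    rw [intervalIntegral.integral_const_mul, intervalIntegral.integral_comp_sub_left, hc]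
    congr 2 <;> ring
  have hT : 0 < 2 * Real.pi * t := by positivity
  have h5 : (v + M) * (3 / 4 * (2 * Real.pi * t)) ≤ M * (2 * Real.pi * t) := by
    refine (mul_le_mul_of_nonneg_left hwin (by linarith)).trans ?_
    rw [← heq, ← hPint]; exact hlow.trans hmono
  have h6 : (v + M) * (3 / 4) ≤ M := by
    rw [← mul_assoc] at h5
    exact le_of_mul_le_mul_right h5 hT
  linarith

lemma contraction_bound (t : ℕ) (ht : 0 < t) (F : ℝ → ℝ) (C M0 : ℝ) (hC : 0 ≤ C)
    (hint : IntervalIntegrable F volume 0 Real.pi) (hF0 : 0 ≤ F 0) (hFpi : F Real.pi ≤ 0)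
    (hlip : ∀ a b, 0 ≤ a → a ≤ b → b ≤ Real.pi → F a - C * (b - a) ≤ F b)
    (horth : ∀ m : ℤ, m.natAbs ≤ t → ∫ τ in (0:ℝ)..Real.pi, Real.sin (m * τ) * F τ = 0)
    (hM0 : ∀ τ, 0 ≤ τ → τ ≤ Real.pi → |F τ| ≤ M0) (φ : ℝ) (h0 : 0 ≤ φ) (h1 : φ ≤ Real.pi) :
    |F φ| ≤ 3 * C * (4 * Real.pi / t) := by
  have step : ∀ M, (∀ τ, 0 ≤ τ → τ ≤ Real.pi → |F τ| ≤ M) →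
      ∀ τ, 0 ≤ τ → τ ≤ Real.pi → |F τ| ≤ M / 3 + 2 * C * (4 * Real.pi / t) := by
    intro M hM τ hτ0 hτ1
    rw [abs_le']
    refine ⟨contraction t ht F C M hC hint hFpi hlip horth hM τ hτ0 hτ1, ?_⟩
    have := contraction t ht (fun τ => -F (Real.pi - τ)) C M hC ?_ ?_ ?_ ?_ ?_ (Real.pi - τ)
      (by linarith) (by linarith)
    · simpa using this
    · have := (hint.comp_sub_left Real.pi).neg
      simp only [sub_zero, sub_self] at this
      exact this.symm
    · simpa using hF0
    · intro a b ha hab hb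
      have := hlip (Real.pi - b) (Real.pi - a) (by linarith) (by linarith) (by linarith)
      have e : Real.pi - a - (Real.pi - b) = b - a := by ring
      rw [e] at this
      linarith
    · intro m hm
      have h := intervalIntegral.integral_comp_sub_left
        (a := 0) (b := Real.pi) (fun τ => Real.sin (m * (Real.pi - τ)) * F τ) Real.pi
      simp only [sub_sub_cancel, sub_zero, sub_self] at h
      have e : ∀ τ, Real.sin (m * (Real.pi - τ)) * F τ
          = -(Real.cos (m * Real.pi)) * (Real.sin (m * τ) * F τ) := by
        intro τ
        rw [mul_sub, Real.sin_sub, Real.sin_int_mul_pi]; ring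
      simp only [e] at h
      rw [intervalIntegral.integral_const_mul, horth m hm, mul_zero] at h
      simp only [mul_neg, intervalIntegral.integral_neg]
      rw [h, neg_zero]
    · intro τ a b
      rw [abs_neg]
      exact hM _ (by linarith) (by linarith)
  set S := (fun τ => |F τ|) '' Set.Icc 0 Real.pi with hS
  have hbdd : BddAbove S := ⟨M0, by rintro _ ⟨τ, hτ, rfl⟩; exact hM0 τ hτ.1 hτ.2⟩
  have hmem : ∀ τ, 0 ≤ τ → τ ≤ Real.pi → |F τ| ≤ sSup S :=
    fun τ a b => le_csSup hbdd ⟨τ, ⟨a, b⟩, rfl⟩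
  have h2 : sSup S ≤ sSup S / 3 + 2 * C * (4 * Real.pi / t) := by
    refine csSup_le ⟨_, φ, ⟨h0, h1⟩, rfl⟩ ?_
    rintro _ ⟨τ, hτ, rfl⟩
    exact step _ hmem τ hτ.1 hτ.2
  have := hmem φ h0 h1
  linarith

lemma design_poly (d t : ℕ) (X : Finset (EuclideanSpace ℝ (Fin (d + 1)))) (h : IsSphericalDesign d t X)
    (y : EuclideanSpace ℝ (Fin (d + 1))) (q : Polynomial ℝ) (hq : q.natDegree ≤ t) :
    (X.card : ℝ)⁻¹ * ∑ x ∈ X, q.eval ⟪x, y⟫ = ∫ x, q.eval ⟪x, y⟫ ∂(sphereMeasure d) := by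
  set L : MvPolynomial (Fin (d+1)) ℝ := ∑ i, MvPolynomial.C (y i) * MvPolynomial.X i with hL
  have hLd : L.totalDegree ≤ 1 := by
    refine (MvPolynomial.totalDegree_finsetSum _ _).trans ?_
    refine Finset.sup_le fun i _ => ?_
    refine (MvPolynomial.totalDegree_mul _ _).trans ?_
    simp
  have hdeg : (Polynomial.aeval L q).totalDegree ≤ t := by
    rw [Polynomial.aeval_eq_sum_range]
    refine (MvPolynomial.totalDegree_finsetSum _ _).trans ?_
    refine Finset.sup_le fun i hi => ?_
    refine (MvPolynomial.totalDegree_smul_le _ _).trans ?_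
    refine (MvPolynomial.totalDegree_pow _ _).trans ?_
    have := Finset.mem_range.1 hi
    nlinarith
  have hev : ∀ x : EuclideanSpace ℝ (Fin (d + 1)),
      MvPolynomial.eval (fun i => x i) (Polynomial.aeval L q) = q.eval ⟪x, y⟫ := by
    intro x
    have h1 : MvPolynomial.eval (fun i => x i) L = ⟪x, y⟫ := by
      simp [hL, PiLp.inner_apply]
    rw [← h1]
    have := Polynomial.hom_eval₂ q (algebraMap ℝ (MvPolynomial (Fin (d+1)) ℝ))
      (MvPolynomial.eval (fun i => x i)) L
    rw [Polynomial.aeval_def, this]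
    have e : (MvPolynomial.eval (fun i => x i)).comp (algebraMap ℝ (MvPolynomial (Fin (d+1)) ℝ))
        = RingHom.id ℝ := by
      ext r; simp [MvPolynomial.algebraMap_eq]
    rw [e]; rfl
  have := h _ hdeg
  simpa only [hev] using this

lemma sin_ind (m : ℤ) (hm : m ≠ 0) (u : ℝ) (h1 : -1 ≤ u) (h2 : u ≤ 1) :
    ∫ τ in (0:ℝ)..Real.pi, Real.sin (m * τ) * (if Real.cos τ < u then 1 else 0)
      = (Polynomial.C ((m : ℝ)⁻¹) * (Polynomial.Chebyshev.T ℝ m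
        - Polynomial.C (Real.cos (m * Real.pi)))).eval u := by
  have hp := Real.pi_pos
  have hm' : (m : ℝ) ≠ 0 := by exact_mod_cast hm
  obtain ⟨θ, hθ⟩ : ∃ θ, θ = Real.arccos u := ⟨_, rfl⟩
  have h0 : 0 ≤ θ := hθ ▸ Real.arccos_nonneg u
  have hpi : θ ≤ Real.pi := hθ ▸ Real.arccos_le_pi u
  have hu : Real.cos θ = u := by rw [hθ, Real.cos_arccos h1 h2]
  have hr : ∫ τ in (0:ℝ)..Real.pi, Real.sin (m * τ) * (if Real.cos τ < u then 1 else 0)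
      = ∫ τ in θ..Real.pi, Real.sin (m * τ) := by
    rw [intervalIntegral.integral_of_le hp.le, intervalIntegral.integral_of_le hpi]
    have : Set.Ioc θ Real.pi = Set.Ioc 0 Real.pi ∩ Set.Ioc θ Real.pi := by
      rw [Set.Ioc_inter_Ioc, max_eq_right h0, min_self]
    rw [this, ← setIntegral_indicator measurableSet_Ioc]
    refine setIntegral_congr_fun measurableSet_Ioc fun τ hτ => ?_
    have hiff : Real.cos τ < u ↔ τ ∈ Set.Ioc θ Real.pi := by
      rw [← hu, Real.strictAntiOn_cos.lt_iff_gt ⟨hτ.1.le, hτ.2⟩ ⟨h0, hpi⟩]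
      exact ⟨fun h => ⟨h, hτ.2⟩, fun h => h.1⟩
    by_cases hc : Real.cos τ < u
    · simp [hc, Set.indicator_of_mem (hiff.1 hc)]
    · simp [hc, Set.indicator_of_notMem (fun h => hc (hiff.2 h))]
  rw [hr, intervalIntegral.integral_comp_mul_left (fun s => Real.sin s) hm', integral_sin]
  rw [Polynomial.eval_mul, Polynomial.eval_sub, Polynomial.eval_C, Polynomial.eval_C, ← hu,
    Polynomial.Chebyshev.T_real_cos]
  rfl

lemma orth_measure {n : ℕ} (ν : Measure (EuclideanSpace ℝ (Fin n))) [IsFiniteMeasure ν]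
    (hν : ∀ᵐ x ∂ν, ‖x‖ = 1) (y : EuclideanSpace ℝ (Fin n)) (hy : ‖y‖ = 1) (m : ℤ) (hm : m ≠ 0) :
    ∫ τ in (0:ℝ)..Real.pi, Real.sin (m * τ) * (ν {x | Real.cos τ < ⟪x, y⟫}).toReal
      = ∫ x, (Polynomial.C ((m : ℝ)⁻¹) * (Polynomial.Chebyshev.T ℝ m
        - Polynomial.C (Real.cos (m * Real.pi)))).eval ⟪x, y⟫ ∂ν := by
  have hp := Real.pi_pos
  have hmeas : Measurable (fun z : ℝ × EuclideanSpace ℝ (Fin n) =>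
      Real.sin (m * z.1) * (if Real.cos z.1 < ⟪z.2, y⟫ then (1:ℝ) else 0)) := by
    refine Measurable.mul (by fun_prop) ?_
    refine Measurable.ite ?_ measurable_const measurable_const
    exact measurableSet_lt (by fun_prop) (by fun_prop)
  have e1 : ∀ τ : ℝ, Real.sin (m * τ) * (ν {x | Real.cos τ < ⟪x, y⟫}).toReal
      = ∫ x, Real.sin (m * τ) * (if Real.cos τ < ⟪x, y⟫ then (1:ℝ) else 0) ∂ν := by
    intro τ
    rw [integral_const_mul]
    congr 1
    have hS : MeasurableSet {x : EuclideanSpace ℝ (Fin n) | Real.cos τ < ⟪x, y⟫} :=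
      measurableSet_lt (by fun_prop) (by fun_prop)
    have := integral_indicator_one (μ := ν) hS
    rw [Measure.real] at this
    rw [← this]
    rfl
  simp only [e1]
  rw [intervalIntegral.integral_of_le hp.le, integral_integral_swap]
  · refine integral_congr_ae ?_
    filter_upwards [hν] with x hx
    have hb : |⟪x, y⟫| ≤ 1 := by
      have := abs_real_inner_le_norm x y
      rwa [hx, hy, one_mul] at this
    rw [← intervalIntegral.integral_of_le hp.le]
    exact sin_ind m hm _ (abs_le.1 hb).1 (abs_le.1 hb).2
  · refine Integrable.of_bound hmeas.aestronglyMeasurable 1 (Filter.Eventually.of_forall fun z => ?_)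
    simp only [Function.uncurry]
    rw [norm_mul]
    refine mul_le_one₀ (Real.abs_sin_le_one _) (norm_nonneg _) ?_
    split_ifs <;> simp

end

open scoped Classical in
/-- there is a constant `C₁(d) > 0` such that every spherical `t`-design `X_N`
on `S^d` has spherical cap discrepancy `D(X_N) ≤ C₁(d)/t`; i.e. for every spherical cap
`C(y,φ) = {x ∈ S^d : ⟨x,y⟩ > cos φ}` the local discrepancy is at most `C₁(d)/t`. -/
theorem design_cap_discrepancy_bound (d : ℕ) (hd : 1 ≤ d) :
    ∃ C : ℝ, 0 < C ∧ ∀ t N : ℕ, 0 < t →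
      ∀ X : Finset (EuclideanSpace ℝ (Fin (d + 1))), X.card = N →
        (∀ x ∈ X, ‖x‖ = 1) → IsSphericalDesign d t X →
        ∀ y : EuclideanSpace ℝ (Fin (d + 1)), ‖y‖ = 1 →
        ∀ φ ∈ Set.Icc (0 : ℝ) Real.pi,
          |(N : ℝ)⁻¹ * ((X.filter fun x => Real.cos φ < ⟪x, y⟫).card : ℝ) -
              (sphereMeasure d {x | Real.cos φ < ⟪x, y⟫}).toReal| ≤ C / t := by
  classical
  obtain ⟨m, rfl⟩ : ∃ m, d = m + 1 := ⟨d - 1, by omega⟩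
  obtain ⟨K, hK, hring⟩ := ring_bound m
  set s := μH[((m + 1 : ℕ) : ℝ)] (Metric.sphere (0 : EuclideanSpace ℝ (Fin (m + 1 + 1))) 1) with hs
  set C1 : ℝ := (s⁻¹ * K).toReal with hC1
  have hC1n : 0 ≤ C1 := ENNReal.toReal_nonneg
  have hp := Real.pi_pos
  refine ⟨12 * Real.pi * C1 + 1, by positivity, ?_⟩
  intro t N ht X hXN hX hdes y hy φ hφ
  have ht' : (0:ℝ) < t := by exact_mod_cast ht
  have hone := hdes 1 (by simp)
  simp only [map_one, Finset.sum_const, nsmul_eq_mul, mul_one, hXN] at hone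
  by_cases hs0 : s = 0
  · have hz : sphereMeasure (m + 1) = 0 := by
      unfold sphereMeasure
      rw [Measure.restrict_eq_zero.2 hs0, smul_zero]
    rw [hz] at hone ⊢
    simp only [integral_zero_measure] at hone
    have hN : (N : ℝ) = 0 := by
      by_contra h
      rw [inv_mul_cancel₀ h] at hone
      exact one_ne_zero hone
    rw [hN]
    simp
    positivity
  have hsT : s ≠ ⊤ := by
    have h := hring y hy 0 Real.pi le_rfl le_rfl
    refine ne_top_of_le_ne_top (ENNReal.mul_ne_top hK ENNReal.ofReal_ne_top) (le_trans ?_ h)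
    refine measure_mono fun x hx => ?_
    have hx1 : ‖x‖ = 1 := by simpa using hx
    have hb : |⟪x, y⟫| ≤ 1 := by
      have := abs_real_inner_le_norm x y
      rwa [hx1, hy, one_mul] at this
    exact ⟨hx1, Real.arccos ⟪x, y⟫, ⟨Real.arccos_nonneg _, Real.arccos_le_pi _⟩,
      Real.cos_arccos (abs_le.1 hb).1 (abs_le.1 hb).2⟩
  set ν := sphereMeasure (m + 1) with hν
  have hsm : MeasurableSet (Metric.sphere (0 : EuclideanSpace ℝ (Fin (m + 1 + 1))) 1) :=
    Metric.isClosed_sphere.measurableSet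
  have hνA : ∀ A, ν A = s⁻¹ * μH[((m + 1 : ℕ) : ℝ)] (A ∩ Metric.sphere 0 1) := by
    intro A
    rw [hν, sphereMeasure, Measure.smul_apply, Measure.restrict_apply' hsm, smul_eq_mul]
  have : IsProbabilityMeasure ν := ⟨by
    rw [hνA, Set.univ_inter]; exact ENNReal.inv_mul_cancel hs0 hsT⟩
  have hae : ∀ᵐ x ∂ν, ‖x‖ = 1 := by
    rw [ae_iff, hνA]
    have : {x : EuclideanSpace ℝ (Fin (m + 1 + 1)) | ¬ ‖x‖ = 1} ∩ Metric.sphere 0 1 = ∅ := by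
      ext x; simp
    rw [this]; simp
  have hN : (0:ℝ) < N := by
    rcases Nat.eq_zero_or_pos N with h | h
    · rw [h] at hone; simp at hone
    · exact_mod_cast h
  have hringν : ∀ a b : ℝ, 0 ≤ a → a ≤ b → b ≤ Real.pi →
      (ν {x | Real.cos b ≤ ⟪x, y⟫ ∧ ⟪x, y⟫ ≤ Real.cos a}).toReal ≤ C1 * (b - a) := by
    intro a b ha hab hb
    have h := hring y hy a b ha hb
    have h2 : ν {x | Real.cos b ≤ ⟪x, y⟫ ∧ ⟪x, y⟫ ≤ Real.cos a}
        ≤ s⁻¹ * K * ENNReal.ofReal (b - a) := by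
      rw [hνA, mul_assoc]
      gcongr
      refine (measure_mono ?_).trans h
      rintro x ⟨⟨h1, h2⟩, hx⟩
      have hx1 : ‖x‖ = 1 := by simpa using hx
      obtain ⟨θ, hθ, he⟩ := intermediate_value_Icc' hab Real.continuous_cos.continuousOn ⟨h1, h2⟩
      exact ⟨hx1, θ, hθ, he⟩
    have h3 := ENNReal.toReal_mono (ENNReal.mul_ne_top (ENNReal.mul_ne_top
      (ENNReal.inv_ne_top.2 hs0) hK) ENNReal.ofReal_ne_top) h2
    rwa [ENNReal.toReal_mul, ENNReal.toReal_ofReal (by linarith)] at h3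
  have hcosmono : ∀ a b : ℝ, 0 ≤ a → a ≤ b → b ≤ Real.pi → Real.cos b ≤ Real.cos a :=
    fun a b ha hab hb => Real.cos_le_cos_of_nonneg_of_le_pi ha hb hab
  set E : ℝ → ℝ := fun τ => (N : ℝ)⁻¹ * ((X.filter fun x => Real.cos τ < ⟪x, y⟫).card : ℝ) with hE
  set V : ℝ → ℝ := fun τ => (ν {x | Real.cos τ < ⟪x, y⟫}).toReal with hV
  have hEmono : ∀ a b : ℝ, 0 ≤ a → a ≤ b → b ≤ Real.pi → E a ≤ E b := by
    intro a b ha hab hb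
    simp only [hE]
    gcongr with x hx
    exact hcosmono a b ha hab hb
  have hVmono : ∀ a b : ℝ, 0 ≤ a → a ≤ b → b ≤ Real.pi → V a ≤ V b := by
    intro a b ha hab hb
    refine ENNReal.toReal_mono (measure_ne_top _ _) (measure_mono fun x hx => ?_)
    exact (hcosmono a b ha hab hb).trans_lt hx
  have hE0 : ∀ τ, 0 ≤ E τ := fun τ => by positivity
  have hE1 : ∀ τ, E τ ≤ 1 := by
    intro τ
    simp only [hE]
    rw [inv_mul_le_iff₀ hN, mul_one, ← hXN]
    exact_mod_cast Finset.card_filter_le _ _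
  have hV0 : ∀ τ, 0 ≤ V τ := fun τ => ENNReal.toReal_nonneg
  have hV1 : ∀ τ, V τ ≤ 1 := fun τ => measureReal_le_one
  have hEi : IntervalIntegrable E volume 0 Real.pi := by
    refine MonotoneOn.intervalIntegrable ?_
    rw [Set.uIcc_of_le hp.le]
    exact fun a ha b hb hab => hEmono a b ha.1 hab hb.2
  have hVi : IntervalIntegrable V volume 0 Real.pi := by
    refine MonotoneOn.intervalIntegrable ?_
    rw [Set.uIcc_of_le hp.le]
    exact fun a ha b hb hab => hVmono a b ha.1 hab hb.2
  have hVlip : ∀ a b : ℝ, 0 ≤ a → a ≤ b → b ≤ Real.pi → V b ≤ V a + C1 * (b - a) := by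
    intro a b ha hab hb
    have h1 : ν {x | Real.cos b < ⟪x, y⟫} ≤ ν {x | Real.cos a < ⟪x, y⟫}
        + ν {x | Real.cos b ≤ ⟪x, y⟫ ∧ ⟪x, y⟫ ≤ Real.cos a} := by
      refine (measure_mono ?_).trans (measure_union_le _ _)
      intro x hx
      rcases lt_or_ge (Real.cos a) ⟪x, y⟫ with h | h
      · exact Or.inl h
      · exact Or.inr ⟨le_of_lt hx, h⟩
    have h2 := ENNReal.toReal_mono (by finiteness) h1
    rw [ENNReal.toReal_add (measure_ne_top _ _) (measure_ne_top _ _)] at h2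
    have := hringν a b ha hab hb
    simp only [hV]; linarith
  have hVpi : 1 ≤ V Real.pi := by
    have h := hringν Real.pi Real.pi hp.le le_rfl le_rfl
    rw [sub_self, mul_zero] at h
    have h1 : ν Set.univ ≤ ν {x | Real.cos Real.pi < ⟪x, y⟫}
        + ν {x | Real.cos Real.pi ≤ ⟪x, y⟫ ∧ ⟪x, y⟫ ≤ Real.cos Real.pi} := by
      refine (measure_mono_ae ?_).trans (measure_union_le _ _)
      filter_upwards [hae] with x hx _
      have hb : |⟪x, y⟫| ≤ 1 := by
        have := abs_real_inner_le_norm x y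
        rwa [hx, hy, one_mul] at this
      have hb1 := (abs_le.1 hb).1
      rw [← Real.cos_pi] at hb1
      rcases lt_or_ge (Real.cos Real.pi) ⟪x, y⟫ with h | h
      · exact Or.inl h
      · exact Or.inr ⟨hb1, h⟩
    rw [measure_univ] at h1
    have h2 := ENNReal.toReal_mono (by finiteness) h1
    rw [ENNReal.toReal_add (measure_ne_top _ _) (measure_ne_top _ _)] at h2
    simp only [ENNReal.toReal_one] at h2
    simp only [hV]; linarith
  have hVz : V 0 = 0 := by
    have : ν {x | Real.cos 0 < ⟪x, y⟫} = 0 := by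
      rw [measure_eq_zero_iff_ae_notMem]
      filter_upwards [hae] with x hx h
      have hb := real_inner_le_norm x y
      rw [hx, hy, one_mul] at hb
      rw [Real.cos_zero] at h
      linarith
    simp only [hV, this, ENNReal.toReal_zero]
  have hEorth : ∀ k : ℤ, k ≠ 0 → ∫ τ in (0:ℝ)..Real.pi, Real.sin (k * τ) * E τ
      = (N : ℝ)⁻¹ * ∑ x ∈ X, (Polynomial.C ((k : ℝ)⁻¹) * (Polynomial.Chebyshev.T ℝ k
        - Polynomial.C (Real.cos (k * Real.pi)))).eval ⟪x, y⟫ := by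
    intro k hk
    have e : ∀ τ, Real.sin (k * τ) * E τ = (N : ℝ)⁻¹ *
        ∑ x ∈ X, Real.sin (k * τ) * (if Real.cos τ < ⟪x, y⟫ then (1:ℝ) else 0) := by
      intro τ
      simp only [hE]
      rw [← Finset.mul_sum, Finset.sum_boole]; ring
    simp only [e]
    rw [intervalIntegral.integral_const_mul, intervalIntegral.integral_finsetSum]
    · congr 1
      refine Finset.sum_congr rfl fun x hx => ?_
      have hb : |⟪x, y⟫| ≤ 1 := by
        have := abs_real_inner_le_norm x y
        rwa [hX x hx, hy, one_mul] at this
      exact sin_ind k hk _ (abs_le.1 hb).1 (abs_le.1 hb).2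
    · intro x _
      refine IntervalIntegrable.continuousOn_mul ?_ (by fun_prop)
      refine MonotoneOn.intervalIntegrable ?_
      rw [Set.uIcc_of_le hp.le]
      intro a ha b hb hab
      have := hcosmono a b ha.1 hab hb.2
      dsimp only
      split_ifs with h1 h2
      · exact le_rfl
      · exact (h2 (this.trans_lt h1)).elim
      · exact zero_le_one
      · exact le_rfl
  have horth : ∀ k : ℤ, k.natAbs ≤ t →
      ∫ τ in (0:ℝ)..Real.pi, Real.sin (k * τ) * (E τ - V τ) = 0 := by
    intro k hk
    by_cases hk0 : k = 0
    · simp [hk0]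
    simp only [mul_sub]
    rw [intervalIntegral.integral_sub (hEi.continuousOn_mul (by fun_prop))
      (hVi.continuousOn_mul (by fun_prop)), hEorth k hk0, orth_measure ν hae y hy k hk0, ← hXN,
      design_poly (m + 1) t X hdes y, sub_self]
    refine (Polynomial.natDegree_C_mul_le _ _).trans ?_
    rw [Polynomial.natDegree_sub_C, Polynomial.Chebyshev.natDegree_T]
    exact hk
  have main := contraction_bound t ht (fun τ => E τ - V τ) C1 1 hC1n (hEi.sub hVi)
    (by simp only [hVz, sub_zero]; exact hE0 0) (by linarith [hE1 Real.pi])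
    (fun a b ha hab hb => by linarith [hEmono a b ha hab hb, hVlip a b ha hab hb])
    horth (fun τ _ _ => by
      rw [abs_le]; constructor <;> linarith [hE0 τ, hE1 τ, hV0 τ, hV1 τ]) φ hφ.1 hφ.2
  have fin : |E φ - V φ| ≤ (12 * Real.pi * C1 + 1) / t := by
    refine main.trans ?_
    rw [show 3 * C1 * (4 * Real.pi / t) = (12 * Real.pi * C1) / t by ring]
    gcongr
    linarith
  convert fin using 6
end

section
/- Let X_N be a spherical t-design on S^d with N points. Then for every x ∈ S^d and every r with 0 ≤ r < 1, the Riesz (d-1)-potential of the equal-weight measure on X_N satisfies |(1/N) Σ_{y ∈ X_N} ‖r·x - y‖^{-(d-1)} - 1| ≤ binom(t+d-1, d-2) · r^{t+1} / (1-r)^{d-1}. -/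
open MeasureTheory

section
open Polynomial

/-- Gegenbauer polynomials with parameter `l`, by the three-term recurrence. -/
noncomputable def geg (l : ℝ) : ℕ → ℝ[X]
  | 0 => 1
  | 1 => C (2 * l) * X
  | (n + 2) => C (((n : ℝ) + 2)⁻¹) *
      (C (2 * ((n : ℝ) + 1 + l)) * X * geg l (n + 1) - C ((n : ℝ) + 2 * l) * geg l n)

theorem geg_rec (l : ℝ) (n : ℕ) :
    C ((n : ℝ) + 2) * geg l (n + 2) =
      C (2 * ((n : ℝ) + 1 + l)) * X * geg l (n + 1) - C ((n : ℝ) + 2 * l) * geg l n := by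
  rw [geg, ← mul_assoc, ← C_mul, mul_inv_cancel₀ (by positivity), C_1, one_mul]

theorem geg_natDegree (l : ℝ) (n : ℕ) : (geg l n).natDegree ≤ n ∧ (geg l (n+1)).natDegree ≤ n+1 := by
  induction n with
  | zero =>
    constructor
    · simp [geg]
    · exact (natDegree_C_mul_le _ _).trans natDegree_X_le
  | succ n ih =>
    refine ⟨ih.2, ?_⟩
    rw [geg]
    refine (natDegree_C_mul_le _ _).trans ((natDegree_sub_le _ _).trans (max_le ?_ ?_))
    · rw [mul_assoc]
      refine (natDegree_C_mul_le _ _).trans (natDegree_mul_le.trans ?_)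
      have := ih.2
      have := natDegree_X_le (R := ℝ)
      omega
    · exact (natDegree_C_mul_le _ _).trans (by omega)

theorem geg_PQ (l : ℝ) (n : ℕ) :
    (X * derivative (geg l (n+1)) - derivative (geg l n) = C ((n : ℝ) + 1) * geg l (n+1)) ∧
    (derivative (geg l (n+1)) - X * derivative (geg l n) = C ((n : ℝ) + 2 * l) * geg l n) := by
  induction n with
  | zero =>
    constructor <;> (simp [geg]; try ring)
  | succ n ih =>
    obtain ⟨hP, hQ⟩ := ih
    have hr := geg_rec l n
    have hdr := congrArg derivative hr
    simp only [derivative_mul, derivative_sub, derivative_C, derivative_X, zero_mul, zero_add, mul_one] at hdr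
    have hne : (C ((n : ℝ) + 2)) ≠ 0 := by
      rw [Ne, C_eq_zero]; positivity
    simp only [C_mul, C_add, Nat.cast_add, Nat.cast_one, C_1] at *
    have hC2 : (C (2 : ℝ)) = (2 : ℝ[X]) := rfl
    simp only [hC2] at *
    have hQ' : derivative (geg l (n+1+1)) - X * derivative (geg l (n+1)) = (C (n : ℝ) + 1 + 2 * C l) * geg l (n+1) := by
      apply mul_left_cancel₀ hne
      linear_combination hdr + (C (n:ℝ) + 2 * C l) * hP
    refine ⟨?_, hQ'⟩
    linear_combination X * hQ' - hr + X * hP - hQ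

theorem geg_ode (l : ℝ) (n : ℕ) :
    (1 - X ^ 2) * derivative (derivative (geg l (n+1))) - C (2 * l + 1) * X * derivative (geg l (n+1))
      = - C (((n : ℝ) + 1) * (n + 1 + 2 * l)) * geg l (n+1) := by
  obtain ⟨hP, hQ⟩ := geg_PQ l n
  have hdP := congrArg derivative hP
  have hdQ := congrArg derivative hQ
  simp only [derivative_mul, derivative_sub, derivative_C, derivative_X, zero_mul, zero_add, one_mul] at hdP hdQ
  simp only [C_mul, C_add, C_1] at *
  have hC2 : (C (2 : ℝ)) = (2 : ℝ[X]) := rfl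
  simp only [hC2] at *
  linear_combination hdQ - X * hdP - (C (n:ℝ) + 2 * C l) * hP - hP

/-- Coefficients of `(1-z)^(-l)`. -/
noncomputable def acoef (l : ℝ) : ℕ → ℝ
  | 0 => 1
  | (k + 1) => ((k : ℝ) + l) / (k + 1) * acoef l k

theorem acoef_nonneg (l : ℝ) (hl : 0 ≤ l) (k : ℕ) : 0 ≤ acoef l k := by
  induction k with
  | zero => simp [acoef]
  | succ k ih => rw [acoef]; positivity

/-- The convolution coefficients. -/
noncomputable def gcoef (l : ℝ) (w v : ℂ) (n : ℕ) : ℂ :=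
  ∑ p ∈ Finset.HasAntidiagonal.antidiagonal n, ((acoef l p.1 : ℂ) * w ^ p.1) * ((acoef l p.2 : ℂ) * v ^ p.2)

section
open PowerSeries

/-- The power series of `(1-wz)^(-l)`. -/
noncomputable def Fser (l : ℝ) (w : ℂ) : PowerSeries ℂ :=
  PowerSeries.mk (fun k => (acoef l k : ℂ) * w ^ k)

theorem Fser_deriv (l : ℝ) (w : ℂ) :
    (1 - PowerSeries.C w * PowerSeries.X) * PowerSeries.derivative ℂ (Fser l w) = PowerSeries.C (l * w) * Fser l w := by
  ext n
  rw [sub_mul, one_mul, mul_assoc, map_sub, PowerSeries.coeff_C_mul, PowerSeries.coeff_C_mul]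
  cases n with
  | zero =>
    simp [PowerSeries.coeff_derivative, Fser, acoef]
  | succ n =>
    rw [PowerSeries.coeff_succ_X_mul, PowerSeries.coeff_derivative, PowerSeries.coeff_derivative]
    simp only [Fser, PowerSeries.coeff_mk]
    rw [acoef]
    push_cast
    have : ((n : ℂ) + 1 + 1) ≠ 0 := by exact_mod_cast (by positivity : ((n:ℝ)+1+1) ≠ 0)
    field_simp
    ring

theorem gcoef_eq (l : ℝ) (w v : ℂ) (n : ℕ) :
    gcoef l w v n = PowerSeries.coeff n (Fser l w * Fser l v) := by
  simp [gcoef, PowerSeries.coeff_mul, Fser]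

theorem Gser_deriv (l : ℝ) (w v : ℂ) :
    PowerSeries.derivative ℂ (Fser l w * Fser l v) - PowerSeries.C (w + v) * (PowerSeries.X * PowerSeries.derivative ℂ (Fser l w * Fser l v))
      + PowerSeries.C (w * v) * (PowerSeries.X * (PowerSeries.X * PowerSeries.derivative ℂ (Fser l w * Fser l v)))
    = PowerSeries.C (l * (w + v)) * (Fser l w * Fser l v) - PowerSeries.C (2 * l * (w * v)) * (PowerSeries.X * (Fser l w * Fser l v)) := by
  have h1 := Fser_deriv l w
  have h2 := Fser_deriv l v
  rw [Derivation.leibniz]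
  simp only [smul_eq_mul, map_mul, map_add] at *
  have hC2 : (PowerSeries.C (2 : ℂ)) = 2 := rfl
  rw [hC2]
  linear_combination (1 - PowerSeries.C v * PowerSeries.X) * Fser l v * h1 + (1 - PowerSeries.C w * PowerSeries.X) * Fser l w * h2

theorem gcoef_zero (l : ℝ) (w v : ℂ) : gcoef l w v 0 = 1 := by simp [gcoef, acoef]

theorem gcoef_one (l : ℝ) (w v : ℂ) : gcoef l w v 1 = l * (w + v) := by
  simp [gcoef, acoef, Finset.Nat.antidiagonal_succ]; ring

theorem gcoef_rec (l : ℝ) (w v : ℂ) (n : ℕ) :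
    ((n : ℂ) + 2) * gcoef l w v (n + 2) = (w + v) * ((n : ℂ) + 1 + l) * gcoef l w v (n + 1)
      - (w * v) * ((n : ℂ) + 2 * l) * gcoef l w v n := by
  have h := congrArg (PowerSeries.coeff (n + 1)) (Gser_deriv l w v)
  simp only [map_sub, (PowerSeries.coeff (R := ℂ) (n+1)).map_add, PowerSeries.coeff_C_mul, PowerSeries.coeff_succ_X_mul, PowerSeries.coeff_derivative,
    ← gcoef_eq] at h
  cases n with
  | zero =>
    simp only [PowerSeries.coeff_zero_X_mul] at h
    push_cast at *
    linear_combination h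
  | succ n =>
    simp only [PowerSeries.coeff_succ_X_mul, PowerSeries.coeff_derivative, ← gcoef_eq] at h
    push_cast at *
    linear_combination h

end

theorem gcoef_geg (l : ℝ) (w v : ℂ) (s : ℝ) (h1 : w + v = 2 * s) (h2 : w * v = 1) (n : ℕ) :
    gcoef l w v n = ((geg l n).eval s : ℝ) ∧ gcoef l w v (n+1) = ((geg l (n+1)).eval s : ℝ) := by
  induction n with
  | zero => 
    constructor
    · simp [geg, gcoef_zero]
    · rw [gcoef_one, h1]; simp [geg]; ring
  | succ n ih =>
    refine ⟨ih.2, ?_⟩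
    have hne : ((n : ℂ) + 2) ≠ 0 := by exact_mod_cast (by positivity : ((n:ℝ)+2) ≠ 0)
    apply mul_left_cancel₀ hne
    rw [gcoef_rec, h1, h2, ih.1, ih.2]
    have := congrArg (eval s) (geg_rec l n)
    simp only [eval_mul, eval_C, eval_sub, eval_X] at this
    have := congrArg (Complex.ofReal) this
    push_cast at this
    rw [this]
    ring

/-- at `w = v = 1`, `2 l = m + 1`. -/
theorem gcoef_one_one (l : ℝ) (m : ℕ) (hm : 2 * l = m + 1) (n : ℕ) :
    gcoef l 1 1 n = (Nat.choose (n + m) m : ℂ) ∧ gcoef l 1 1 (n+1) = (Nat.choose (n + 1 + m) m : ℂ) := by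
  have hm' : (2 * l : ℂ) = m + 1 := by exact_mod_cast hm
  have key : ∀ k : ℕ, ((k : ℂ) + 1) * (Nat.choose (k + 1 + m) m : ℂ) = ((k : ℂ) + 1 + m) * (Nat.choose (k + m) m : ℂ) := by
    intro k
    have h := Nat.add_one_mul_choose_eq (k + m) k
    have e1 : (k + m).choose k = (k + m).choose m := by
      rw [Nat.choose_symm_add]
    have e2 : (k + m + 1).choose (k + 1) = (k + 1 + m).choose m := by
      rw [show k + m + 1 = (k + 1) + m by ring, Nat.choose_symm_add]
    rw [e1, e2] at h
    have := congrArg (Nat.cast (R := ℂ)) h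
    push_cast at this
    linear_combination -this
  induction n with
  | zero =>
    constructor
    · simp [gcoef_zero]
    · rw [gcoef_one]
      have := key 0
      simp at this ⊢
      rw [this]
      linear_combination hm'
  | succ n ih =>
    refine ⟨ih.2, ?_⟩
    have hne : ((n : ℂ) + 2) ≠ 0 := by exact_mod_cast (by positivity : ((n:ℝ)+2) ≠ 0)
    apply mul_left_cancel₀ hne
    rw [gcoef_rec, ih.1, ih.2]
    have k1 := key n
    have k2 := key (n+1)
    push_cast at *
    linear_combination (-1 : ℂ) * k2 + k1 +  ((Nat.choose (n+1+m) m : ℂ) - (Nat.choose (n+m) m : ℂ)) * hm'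

theorem gcoef_scale (l : ℝ) (c w v : ℂ) (n : ℕ) : gcoef l (c * w) (c * v) n = c ^ n * gcoef l w v n := by
  rw [gcoef, gcoef, Finset.mul_sum]
  refine Finset.sum_congr rfl fun p hp => ?_
  rw [← Finset.HasAntidiagonal.mem_antidiagonal.1 hp, mul_pow, mul_pow, pow_add]
  ring

theorem acoef_conv (l : ℝ) (m : ℕ) (hm : 2 * l = m + 1) (n : ℕ) :
    ∑ p ∈ Finset.HasAntidiagonal.antidiagonal n, acoef l p.1 * acoef l p.2 = (Nat.choose (n + m) m : ℝ) := by
  have := (gcoef_one_one l m hm n).1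
  rw [gcoef] at this
  simp only [one_pow, mul_one] at this
  exact_mod_cast this

theorem gcoef_bound (l : ℝ) (m : ℕ) (hm : 2 * l = m + 1) (w v : ℂ) (hw : ‖w‖ = 1) (hv : ‖v‖ = 1) (n : ℕ) :
    ‖gcoef l w v n‖ ≤ (Nat.choose (n + m) m : ℝ) := by
  have hl : 0 ≤ l := by have : (0:ℝ) ≤ m := by positivity
                        linarith
  rw [← acoef_conv l m hm, gcoef]
  refine (norm_sum_le _ _).trans (Finset.sum_le_sum fun p _ => ?_)
  simp [hw, hv, abs_of_nonneg (acoef_nonneg l hl _)]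

theorem acoef_le (l : ℝ) (m : ℕ) (hm : 2 * l = m + 1) (n : ℕ) :
    acoef l n ≤ (Nat.choose (n + m) m : ℝ) := by
  have hl : 0 ≤ l := by have : (0:ℝ) ≤ m := by positivity
                        linarith
  rw [← acoef_conv l m hm]
  have := Finset.single_le_sum (f := fun p : ℕ × ℕ => acoef l p.1 * acoef l p.2) (s := Finset.HasAntidiagonal.antidiagonal n)
    (fun p _ => mul_nonneg (acoef_nonneg l hl _) (acoef_nonneg l hl _)) (a := (n, 0)) (by simp)
  simpa [acoef] using this

theorem acoef_summable (l : ℝ) (m : ℕ) (hm : 2 * l = m + 1) (z : ℂ) (hz : ‖z‖ < 1) :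
    Summable (fun k => ‖(acoef l k : ℂ) * z ^ k‖) := by
  have hl : 0 ≤ l := by have : (0:ℝ) ≤ m := by positivity
                        linarith
  have h := (hasSum_choose_mul_geometric_of_norm_lt_one (𝕜 := ℝ) m (r := ‖z‖) (by simpa using hz)).summable
  refine Summable.of_nonneg_of_le (fun _ => norm_nonneg _) (fun k => ?_) h
  rw [norm_mul, norm_pow, Complex.norm_real, Real.norm_of_nonneg (acoef_nonneg l hl _)]
  exact mul_le_mul_of_nonneg_right (acoef_le l m hm k) (by positivity)

theorem gcoef_hasSum (l : ℝ) (m : ℕ) (hm : 2 * l = m + 1) (z z' : ℂ) (hz : ‖z‖ < 1) (hz' : ‖z'‖ < 1) :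
    HasSum (fun n => gcoef l z z' n) ((∑' k, (acoef l k : ℂ) * z ^ k) * (∑' k, (acoef l k : ℂ) * z' ^ k)) := by
  have s1 := acoef_summable l m hm z hz
  have s2 := acoef_summable l m hm z' hz'
  rw [tsum_mul_tsum_eq_tsum_sum_antidiagonal_of_summable_norm s1 s2]
  exact (summable_norm_sum_mul_antidiagonal_of_summable_norm s1 s2).of_norm.hasSum

theorem Fsq (l : ℝ) (m : ℕ) (hm : 2 * l = m + 1) (z : ℂ) (hz : ‖z‖ < 1) :
    (∑' k, (acoef l k : ℂ) * z ^ k) * (∑' k, (acoef l k : ℂ) * z ^ k) = 1 / (1 - z) ^ (m + 1) := by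
  refine (gcoef_hasSum l m hm z z hz hz).unique ?_
  convert! hasSum_choose_mul_geometric_of_norm_lt_one m hz using 2 with n
  have := gcoef_scale l z 1 1 n
  rw [mul_one, (gcoef_one_one l m hm n).1] at this
  rw [this, mul_comm]

theorem exists_w (s : ℝ) (hs : |s| ≤ 1) : ∃ w : ℂ, ‖w‖ = 1 ∧ w.re = s := by
  have h1 : 0 ≤ 1 - s ^ 2 := by nlinarith [abs_nonneg s, sq_abs s]
  refine ⟨⟨s, √(1 - s ^ 2)⟩, ?_, rfl⟩
  have : ‖(⟨s, √(1 - s ^ 2)⟩ : ℂ)‖ ^ 2 = 1 := by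
    rw [Complex.sq_norm, Complex.normSq_mk, Real.mul_self_sqrt h1]; ring
  exact (pow_eq_one_iff_of_nonneg (norm_nonneg _) two_ne_zero).1 this

theorem w_props (w : ℂ) (s : ℝ) (hw : ‖w‖ = 1) (hre : w.re = s) :
    w + star w = 2 * s ∧ w * star w = 1 ∧ ‖star w‖ = 1 := by
  refine ⟨?_, ?_, ?_⟩
  · have := Complex.add_conj w
    rw [hre] at this
    simpa using this
  · have := Complex.mul_conj w
    rw [Complex.normSq_eq_norm_sq, hw] at this
    simpa using this
  · rw [norm_star, hw]

theorem geg_bound (l : ℝ) (m : ℕ) (hm : 2 * l = m + 1) (s : ℝ) (hs : |s| ≤ 1) (n : ℕ) :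
    |(geg l n).eval s| ≤ (Nat.choose (n + m) m : ℝ) := by
  obtain ⟨w, hw, hre⟩ := exists_w s hs
  obtain ⟨h1, h2, h3⟩ := w_props w s hw hre
  have := gcoef_bound l m hm w (star w) hw h3 n
  rwa [(gcoef_geg l w (star w) s h1 h2 n).1, Complex.norm_real] at this

theorem geg_hasSum (l : ℝ) (m : ℕ) (hm : 2 * l = m + 1) (s : ℝ) (hs : |s| ≤ 1) (r : ℝ) (hr0 : 0 ≤ r) (hr1 : r < 1)
    (D : ℝ) (hD0 : 0 ≤ D) (hD : D ^ 2 = 1 - 2 * r * s + r ^ 2) :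
    HasSum (fun n => r ^ n * (geg l n).eval s) (D ^ (m + 1))⁻¹ := by
  obtain ⟨w, hw, hre⟩ := exists_w s hs
  obtain ⟨h1, h2, h3⟩ := w_props w s hw hre
  have hn : ‖(r : ℂ) * w‖ < 1 := by
    rw [norm_mul, hw, Complex.norm_real, Real.norm_of_nonneg hr0]; linarith
  have hn' : ‖(r : ℂ) * star w‖ < 1 := by
    rw [norm_mul, h3, Complex.norm_real, Real.norm_of_nonneg hr0]; linarith
  have hS := gcoef_hasSum l m hm _ _ hn hn'
  have hstar : (∑' k, (acoef l k : ℂ) * ((r : ℂ) * star w) ^ k) = star (∑' k, (acoef l k : ℂ) * ((r : ℂ) * w) ^ k) := by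
    rw [show star (∑' k, (acoef l k : ℂ) * ((r : ℂ) * w) ^ k) = _ from tsum_star]
    refine tsum_congr fun k => ?_
    simp
  have hsq := congrArg norm (Fsq l m hm _ hn)
  have hDn : ‖1 - (r : ℂ) * w‖ = D := by
    have : ‖1 - (r : ℂ) * w‖ ^ 2 = D ^ 2 := by
      have hh : w.re * w.re + w.im * w.im = 1 := by
        rw [← Complex.normSq_apply, Complex.normSq_eq_norm_sq, hw]; norm_num
      rw [hD, Complex.sq_norm, Complex.normSq_apply]
      simp
      rw [← hre]
      linear_combination r ^ 2 * hh
    exact (sq_eq_sq₀ (norm_nonneg _) hD0).1 this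
  rw [norm_div, norm_pow, hDn, norm_one, norm_mul, one_div] at hsq
  have hval : ((∑' k, (acoef l k : ℂ) * ((r : ℂ) * w) ^ k) * (∑' k, (acoef l k : ℂ) * ((r : ℂ) * star w) ^ k)) = (((D ^ (m + 1))⁻¹ : ℝ) : ℂ) := by
    rw [hstar, ← hsq]
    have := Complex.mul_conj (∑' k, (acoef l k : ℂ) * ((r : ℂ) * w) ^ k)
    rw [Complex.normSq_eq_norm_sq, sq] at this
    exact this
  rw [hval] at hS
  rw [← Complex.hasSum_ofReal]
  convert hS using 2 with n
  rw [gcoef_scale, (gcoef_geg l w (star w) s h1 h2 n).1]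
  push_cast
  rfl

theorem choose_mul_le (a b m : ℕ) : Nat.choose (a + b + m) m ≤ Nat.choose (a + m) m * Nat.choose (b + m) m := by
  induction m with
  | zero => simp
  | succ m ih =>
    have h1 := Nat.add_one_mul_choose_eq (a + b + m) m
    have h2 := Nat.add_one_mul_choose_eq (a + m) m
    have h3 := Nat.add_one_mul_choose_eq (b + m) m
    simp only [← add_assoc] at *
    have h4 : (a + b + m + 1) * (m + 1) ≤ (a + m + 1) * (b + m + 1) := by nlinarith [Nat.zero_le (a*b)]
    have hpos : 0 < (m + 1) * (m + 1) := by positivity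
    refine Nat.le_of_mul_le_mul_left ?_ hpos
    calc (m + 1) * (m + 1) * (a + b + m + 1).choose (m + 1) = (a + b + m + 1) * (m + 1) * (a + b + m).choose m := by
          linear_combination (m + 1) * h1.symm
      _ ≤ ((a + m + 1) * (b + m + 1)) * ((a + m).choose m * (b + m).choose m) := Nat.mul_le_mul h4 ih
      _ = _ := by
          calc _ = ((a + m + 1) * (a + m).choose m) * ((b + m + 1) * (b + m).choose m) := by ring
            _ = _ := by rw [h2, h3]; ring

theorem tail_bound (m t : ℕ) (r : ℝ) (hr0 : 0 ≤ r) (hr1 : r < 1) (b : ℕ → ℝ) (S : ℝ)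
    (hb : ∀ n, |b n| ≤ (Nat.choose (n + m) m : ℝ)) (h0 : b 0 = 1) (hz : ∀ n, 1 ≤ n → n ≤ t → b n = 0)
    (hS : HasSum (fun n => r ^ n * b n) S) :
    |S - 1| ≤ (Nat.choose (t + 1 + m) m : ℝ) * r ^ (t + 1) / (1 - r) ^ (m + 1) := by
  have h1 := (hasSum_nat_add_iff' (t + 1)).2 hS
  have h2 : ∑ i ∈ Finset.range (t + 1), r ^ i * b i = 1 := by
    rw [Finset.sum_range_succ', Finset.sum_eq_zero]
    · simp [h0]
    · intro i hi
      rw [hz (i+1) (by omega) (by simpa using hi)]; simp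
  rw [h2] at h1
  have h3 := (hasSum_choose_mul_geometric_of_norm_lt_one (𝕜 := ℝ) m (r := r) (by rwa [Real.norm_of_nonneg hr0])).mul_left ((Nat.choose (t + 1 + m) m : ℝ) * r ^ (t + 1))
  rw [mul_one_div] at h3
  rw [← h1.tsum_eq, ← h3.tsum_eq, ← Real.norm_eq_abs]
  refine tsum_of_norm_bounded h3.summable.hasSum fun n => ?_
  rw [norm_mul, norm_pow, Real.norm_of_nonneg hr0, Real.norm_eq_abs]
  have hc : (Nat.choose (n + (t + 1) + m) m : ℝ) ≤ (Nat.choose (t + 1 + m) m : ℝ) * (Nat.choose (n + m) m : ℝ) := by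
    have := choose_mul_le (t + 1) n m
    rw [add_comm n (t+1)]
    exact_mod_cast this
  calc r ^ (n + (t + 1)) * |b (n + (t + 1))| ≤ r ^ (n + (t + 1)) * ((Nat.choose (t + 1 + m) m : ℝ) * (Nat.choose (n + m) m : ℝ)) :=
        mul_le_mul_of_nonneg_left ((hb _).trans hc) (by positivity)
    _ = _ := by rw [pow_add]; ring



theorem sphereMeasure_ae (d : ℕ) : ∀ᵐ y ∂(sphereMeasure d), ‖y‖ = 1 := by
  have : ∀ᵐ y ∂((μH[(d : ℝ)]).restrict (Metric.sphere (0 : EuclideanSpace ℝ (Fin (d + 1))) 1)), ‖y‖ = 1 := by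
    filter_upwards [ae_restrict_mem Metric.isClosed_sphere.measurableSet] with y hy
    simpa using hy
  exact Measure.ae_smul_measure this _

theorem sphereMeasure_mp (d : ℕ) (e : (EuclideanSpace ℝ (Fin (d + 1))) ≃ₗᵢ[ℝ] (EuclideanSpace ℝ (Fin (d + 1)))) :
    MeasurePreserving e (sphereMeasure d) (sphereMeasure d) := by
  have h := e.toIsometryEquiv.measurePreserving_hausdorffMeasure (d : ℝ)
  have h2 := h.restrict_preimage (s := Metric.sphere (0 : EuclideanSpace ℝ (Fin (d + 1))) 1) Metric.isClosed_sphere.measurableSet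
  have h3 : e.toIsometryEquiv ⁻¹' (Metric.sphere (0 : EuclideanSpace ℝ (Fin (d + 1))) 1) = Metric.sphere (0 : EuclideanSpace ℝ (Fin (d + 1))) 1 := by
    ext y; simp
  rw [h3] at h2
  exact h2.smul_measure _

theorem int_radial (d : ℕ) (f : ℝ → ℝ) (u v : EuclideanSpace ℝ (Fin (d + 1))) (h : ‖u‖ = ‖v‖) :
    ∫ y, f (inner ℝ u y) ∂(sphereMeasure d) = ∫ y, f (inner ℝ v y) ∂(sphereMeasure d) := by
  set e := (Submodule.span ℝ {u - v})ᗮ.reflection with he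
  have hu : e u = v := Submodule.reflection_sub h
  have := (sphereMeasure_mp d e).integral_comp e.toHomeomorph.measurableEmbedding (fun y => f (inner ℝ v y))
  rw [← this]
  refine integral_congr_ae (Filter.Eventually.of_forall fun y => ?_)
  simp only
  rw [← hu, LinearIsometryEquiv.inner_map_map]

theorem int_cont (d : ℕ) [IsFiniteMeasure (sphereMeasure d)] (f : (EuclideanSpace ℝ (Fin (d + 1))) → ℝ) (hf : Continuous f) :
    Integrable f (sphereMeasure d) := by
  obtain ⟨C, hC⟩ := (isCompact_sphere (0 : EuclideanSpace ℝ (Fin (d + 1))) 1).exists_bound_of_continuousOn hf.continuousOn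
  refine Integrable.of_bound hf.aestronglyMeasurable C ?_
  filter_upwards [sphereMeasure_ae d] with y hy
  exact hC y (by simpa using hy)

theorem int_deriv (d : ℕ) [IsFiniteMeasure (sphereMeasure d)] (F F' : ℝ → (EuclideanSpace ℝ (Fin (d + 1))) → ℝ)
    (hF : ∀ t, Continuous (F t)) (hF' : Continuous (fun p : ℝ × (EuclideanSpace ℝ (Fin (d + 1))) => F' p.1 p.2))
    (hd : ∀ t y, HasDerivAt (fun s => F s y) (F' t y) t) (t : ℝ) :
    HasDerivAt (fun s => ∫ y, F s y ∂(sphereMeasure d)) (∫ y, F' t y ∂(sphereMeasure d)) t := by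
  obtain ⟨C, hC⟩ := ((isCompact_closedBall t 1).prod (isCompact_sphere (0 : EuclideanSpace ℝ (Fin (d + 1))) 1)).exists_bound_of_continuousOn hF'.continuousOn
  refine (hasDerivAt_integral_of_dominated_loc_of_deriv_le (bound := fun _ => C) (Metric.closedBall_mem_nhds t one_pos)
    (Filter.Eventually.of_forall fun s => (hF s).aestronglyMeasurable) (int_cont d _ (hF t))
    (hF'.comp (by fun_prop : Continuous fun y : EuclideanSpace ℝ (Fin (d + 1)) => (t, y))).aestronglyMeasurable ?_ (integrable_const _) ?_).2
  · filter_upwards [sphereMeasure_ae d] with y hy s hs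
    exact hC (s, y) ⟨hs, by simpa using hy⟩
  · exact Filter.Eventually.of_forall fun y s _ => hd s y

theorem int_second (d : ℕ) [IsFiniteMeasure (sphereMeasure d)] (g : ℝ[X]) (x v : EuclideanSpace ℝ (Fin (d + 1))) (hx : ‖x‖ = 1) (hv : ‖v‖ = 1)
    (hxv : inner ℝ x v = 0) :
    ∫ y, ((derivative (derivative g)).eval (inner ℝ x y) * (inner ℝ v y) ^ 2
      - (derivative g).eval (inner ℝ x y) * inner ℝ x y) ∂(sphereMeasure d) = 0 := by
  let L : ℝ → (EuclideanSpace ℝ (Fin (d + 1))) → ℝ := fun s y => Real.cos s * inner ℝ x y + Real.sin s * inner ℝ v y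
  let L' : ℝ → (EuclideanSpace ℝ (Fin (d + 1))) → ℝ := fun s y => -Real.sin s * inner ℝ x y + Real.cos s * inner ℝ v y
  have hL : ∀ s y, HasDerivAt (fun s => L s y) (L' s y) s := fun s y =>
    ((Real.hasDerivAt_cos s).mul_const _).add ((Real.hasDerivAt_sin s).mul_const _)
  have hL' : ∀ s y, HasDerivAt (fun s => L' s y) (-L s y) s := fun s y => by
    have := (((Real.hasDerivAt_sin s).neg).mul_const (inner ℝ x y)).add ((Real.hasDerivAt_cos s).mul_const (inner ℝ v y))
    convert! this using 1
    simp only [L]; ring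
  have cL : Continuous (fun p : ℝ × (EuclideanSpace ℝ (Fin (d + 1))) => L p.1 p.2) := by fun_prop
  have cL' : Continuous (fun p : ℝ × (EuclideanSpace ℝ (Fin (d + 1))) => L' p.1 p.2) := by fun_prop
  have cp : ∀ p : ℝ[X], Continuous (fun s => p.eval s) := fun p => p.continuous
  have cLs : ∀ s, Continuous (L s) := fun s => by fun_prop
  have cLs' : ∀ s, Continuous (L' s) := fun s => by fun_prop
  have hp : ∀ (p : ℝ[X]) s y, HasDerivAt (fun s => p.eval (L s y)) ((derivative p).eval (L s y) * L' s y) s :=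
    fun p s y => HasDerivAt.comp s (h₂ := fun a => p.eval a) (p.hasDerivAt _) (hL s y)
  have d1 := int_deriv d (fun s y => g.eval (L s y)) (fun s y => (derivative g).eval (L s y) * L' s y)
    (fun s => (cp g).comp (cLs s)) (((cp _).comp cL).mul cL')
    (fun s y => hp g s y)
  have d2 := int_deriv d (fun s y => (derivative g).eval (L s y) * L' s y)
    (fun s y => ((derivative (derivative g)).eval (L s y) * L' s y) * L' s y + (derivative g).eval (L s y) * (-L s y))
    (fun s => ((cp _).comp (cLs s)).mul (cLs' s)) (((((cp _).comp cL).mul cL').mul cL').add (((cp _).comp cL).mul cL.neg))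
    (fun s y => (hp (derivative g) s y).mul (hL' s y))
  have hconst : (fun s => ∫ y, g.eval (L s y) ∂(sphereMeasure d)) = fun s => ∫ y, g.eval (inner ℝ x y) ∂(sphereMeasure d) := by
    funext s
    have := int_radial d (fun a => g.eval a) (Real.cos s • x + Real.sin s • v) x (by
      have : ‖Real.cos s • x + Real.sin s • v‖ ^ 2 = ‖x‖ ^ 2 := by
        rw [norm_add_sq_real, norm_smul, norm_smul, inner_smul_left, inner_smul_right, hxv, hx, hv]
        simp
      exact (sq_eq_sq₀ (norm_nonneg _) (norm_nonneg _)).1 this)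
    rw [← this]
    simp only [inner_add_left, inner_smul_left, L]
    rfl
  rw [hconst] at d1
  have z1 : (fun s => ∫ y, (derivative g).eval (L s y) * L' s y ∂(sphereMeasure d)) = fun s => 0 := by
    funext s
    exact (d1 s).unique (hasDerivAt_const s _)
  rw [z1] at d2
  have := (d2 0).unique (hasDerivAt_const (0:ℝ) (0:ℝ))
  rw [← this]
  refine integral_congr_ae (Filter.Eventually.of_forall fun y => ?_)
  simp only [L, L', Real.cos_zero, Real.sin_zero]
  ring_nf

theorem int_ode (d : ℕ) [IsFiniteMeasure (sphereMeasure d)] (g : ℝ[X]) :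
    ∫ y, ((1 - X ^ 2) * derivative (derivative g) - C (d : ℝ) * X * derivative g).eval
      (inner ℝ (EuclideanSpace.single (0 : Fin (d+1)) (1:ℝ)) y) ∂(sphereMeasure d) = 0 := by
  set x : EuclideanSpace ℝ (Fin (d + 1)) := EuclideanSpace.single (0 : Fin (d+1)) (1:ℝ) with hxdef
  have h : ∀ i : Fin d, _ := fun i => int_second d g x (EuclideanSpace.single i.succ (1:ℝ)) (by simp [hxdef]) (by simp) (by
    simp [hxdef, EuclideanSpace.inner_single_left])
  have cp : ∀ p : ℝ[X], Continuous (fun s => p.eval s) := fun p => p.continuous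
  have c1 : ∀ u : EuclideanSpace ℝ (Fin (d + 1)), Continuous (fun y : EuclideanSpace ℝ (Fin (d + 1)) => inner ℝ u y) := fun u => by fun_prop
  have hs : ∑ i : Fin d, ∫ y, ((derivative (derivative g)).eval (inner ℝ x y) * (inner ℝ (EuclideanSpace.single i.succ (1:ℝ)) y) ^ 2
      - (derivative g).eval (inner ℝ x y) * inner ℝ x y) ∂(sphereMeasure d) = 0 := Finset.sum_eq_zero fun i _ => h i
  rw [← integral_finsetSum] at hs
  · rw [← hs]
    refine integral_congr_ae ?_
    filter_upwards [sphereMeasure_ae d] with y hy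
    have hy2 : ∑ i : Fin (d+1), (y i) ^ 2 = 1 := by
      have := EuclideanSpace.real_norm_sq_eq y
      rw [hy] at this
      simpa using this.symm
    rw [Fin.sum_univ_succ] at hy2
    simp only [hxdef, EuclideanSpace.inner_single_left, map_one, one_mul, eval_sub, eval_mul, eval_one, eval_pow, eval_X, eval_C]
    rw [Finset.sum_sub_distrib, ← Finset.mul_sum]
    simp only [Finset.sum_const, Finset.card_univ, Fintype.card_fin, nsmul_eq_mul]
    linear_combination (-eval (y 0) (derivative (derivative g))) * hy2
  · intro i _
    exact int_cont d _ ((((cp _).comp (c1 x)).mul ((c1 _).pow 2)).sub (((cp _).comp (c1 x)).mul (c1 x)))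


theorem normalize_lip (E : Type*) [NormedAddCommGroup E] [NormedSpace ℝ E] :
    LipschitzOnWith 2 (fun x : E => ‖x‖⁻¹ • x) {x | 1 ≤ ‖x‖} := by
  refine LipschitzOnWith.of_dist_le_mul fun x hx y hy => ?_
  simp only [Set.mem_ofPred_eq] at hx hy
  have hx0 : 0 < ‖x‖ := by linarith
  have hy0 : 0 < ‖y‖ := by linarith
  rw [dist_eq_norm, dist_eq_norm]
  have e : ‖x‖⁻¹ • x - ‖y‖⁻¹ • y = ‖x‖⁻¹ • ((x - y) + ((‖y‖ - ‖x‖) * ‖y‖⁻¹) • y) := by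
    rw [smul_add, smul_sub, smul_smul, sub_mul, mul_inv_cancel₀ hy0.ne', mul_sub, mul_one, ← mul_assoc, inv_mul_cancel₀ hx0.ne', one_mul, sub_smul]
    abel
  rw [e, norm_smul, norm_inv, norm_norm]
  have h1 : ‖((‖y‖ - ‖x‖) * ‖y‖⁻¹) • y‖ ≤ ‖x - y‖ := by
    rw [norm_smul, norm_mul, norm_inv, norm_norm, mul_assoc, inv_mul_cancel₀ hy0.ne', mul_one, Real.norm_eq_abs, norm_sub_rev x y]
    exact abs_norm_sub_norm_le y x
  have h2 := norm_add_le (x - y) (((‖y‖ - ‖x‖) * ‖y‖⁻¹) • y)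
  have h3 : ‖x‖⁻¹ ≤ 1 := inv_le_one_of_one_le₀ hx
  calc _ ≤ 1 * (‖x - y‖ + ‖x - y‖) := by gcongr; linarith
    _ = _ := by push_cast; ring

theorem sphere_pos (d : ℕ) : μH[(d : ℝ)] (Metric.sphere (0 : EuclideanSpace ℝ (Fin (d + 1))) 1) ≠ 0 := by
  intro h0
  have hlip : LipschitzWith 1 (fun (y : EuclideanSpace ℝ (Fin (d+1))) (i : Fin d) => y i.succ) := by
    refine LipschitzWith.of_dist_le_mul fun x y => ?_
    rw [NNReal.coe_one, one_mul, dist_pi_le_iff dist_nonneg]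
    intro i
    rw [dist_eq_norm, dist_eq_norm]
    exact PiLp.norm_apply_le (x - y) i.succ
  have h1 := hlip.hausdorffMeasure_image_le (d := (d : ℝ)) (by positivity) (Metric.sphere 0 1)
  rw [h0, mul_zero] at h1
  have h2 := hausdorffMeasure_pi_real (ι := Fin d)
  rw [Fintype.card_fin] at h2
  rw [h2] at h1
  have hopen : IsOpen {v : Fin d → ℝ | ∑ i, v i ^ 2 < 1} := isOpen_lt (by fun_prop) continuous_const
  have hpos := hopen.measure_pos volume ⟨0, by simp⟩
  refine absurd (hpos.trans_le ((measure_mono ?_).trans h1)) (lt_irrefl _)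
  intro v hv
  simp only [Set.mem_ofPred_eq] at hv
  refine ⟨WithLp.toLp 2 (Fin.cons (√(1 - ∑ i, v i ^ 2)) v), ?_, ?_⟩
  · rw [mem_sphere_zero_iff_norm, EuclideanSpace.norm_eq, Fin.sum_univ_succ]
    simp only [Fin.cons_zero, Fin.cons_succ, Real.norm_eq_abs, sq_abs]
    rw [Real.sq_sqrt (by linarith)]
    simp
  · funext i
    simp

theorem sphere_fin (d : ℕ) : μH[(d : ℝ)] (Metric.sphere (0 : EuclideanSpace ℝ (Fin (d + 1))) 1) ≠ ⊤ := by
  let ins : Fin (d+1) → ℝ → (Fin d → ℝ) → EuclideanSpace ℝ (Fin (d+1)) := fun i s v => WithLp.toLp 2 (i.insertNth s v)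
  let f : Fin (d+1) → ℝ → (Fin d → ℝ) → EuclideanSpace ℝ (Fin (d+1)) := fun i s v => ‖ins i s v‖⁻¹ • ins i s v
  let Q : Set (Fin d → ℝ) := Set.Icc (fun _ => -1) (fun _ => 1)
  have hins : ∀ i s, |s| = 1 → ∀ v, 1 ≤ ‖ins i s v‖ := by
    intro i s hs v
    have := PiLp.norm_apply_le (ins i s v) i
    simpa [ins, hs] using this
  have hlip : ∀ i s, |s| = 1 → ∃ K, LipschitzOnWith K (f i s) Q := by
    intro i s hs
    have l1 : LipschitzWith 1 (fun v : Fin d → ℝ => (i.insertNth s v : Fin (d+1) → ℝ)) := by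
      refine LipschitzWith.of_dist_le_mul fun x y => ?_
      rw [Fin.dist_insertNth_insertNth]
      simp
    have l2 := (PiLp.lipschitzWith_toLp 2 (fun _ : Fin (d+1) => ℝ)).comp l1
    exact ⟨_, (normalize_lip _).comp l2.lipschitzOnWith (fun v _ => hins i s hs v)⟩
  have hfin : ∀ i s, |s| = 1 → μH[(d : ℝ)] (f i s '' Q) < ⊤ := by
    intro i s hs
    obtain ⟨K, hK⟩ := hlip i s hs
    refine (hK.hausdorffMeasure_image_le (d := (d:ℝ)) (by positivity)).trans_lt ?_
    have h2 := hausdorffMeasure_pi_real (ι := Fin d)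
    rw [Fintype.card_fin] at h2
    rw [h2]
    refine ENNReal.mul_lt_top ?_ isCompact_Icc.measure_lt_top
    exact ENNReal.rpow_lt_top_of_nonneg (by positivity) (by simp)
  have hcov : Metric.sphere (0 : EuclideanSpace ℝ (Fin (d + 1))) 1 ⊆ (⋃ i, f i 1 '' Q) ∪ (⋃ i, f i (-1) '' Q) := by
    intro y hy
    have hy1 : ‖y‖ = 1 := by simpa using hy
    obtain ⟨i, -, hi⟩ := Finset.exists_max_image Finset.univ (fun i => |y i|) ⟨0, Finset.mem_univ _⟩
    have hne : y i ≠ 0 := by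
      intro h0
      have : y = 0 := by
        ext j
        have := hi j (Finset.mem_univ j)
        rw [h0, abs_zero] at this
        simpa using this
      rw [this] at hy1
      simp at hy1
    have hpos : 0 < |y i| := abs_pos.2 hne
    have key : ∀ s, |s| = 1 → s * |y i| = y i → y ∈ f i s '' Q := by
      intro s hs hsy
      refine ⟨fun j => |y i|⁻¹ * y (i.succAbove j), ?_, ?_⟩
      · have hb : ∀ j : Fin d, |(|y i|⁻¹ * y (i.succAbove j))| ≤ 1 := by
          intro j
          rw [abs_mul, abs_inv, abs_abs, inv_mul_le_iff₀ hpos, mul_one]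
          exact hi _ (Finset.mem_univ _)
        exact ⟨fun j => (abs_le.1 (hb j)).1, fun j => (abs_le.1 (hb j)).2⟩
      · have e : ins i s (fun j => |y i|⁻¹ * y (i.succAbove j)) = |y i|⁻¹ • y := by
          ext j
          rcases Fin.eq_self_or_eq_succAbove i j with rfl | ⟨k, rfl⟩
          · simp only [ins, Fin.insertNth_apply_same, PiLp.smul_apply, smul_eq_mul]
            rw [eq_inv_mul_iff_mul_eq₀ hpos.ne', mul_comm, hsy]
          · simp [ins]
        simp only [f]
        rw [e, norm_smul, hy1, smul_smul]
        simp [hpos.ne']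
    rcases abs_choice (y i) with h | h
    · exact Or.inl (Set.mem_iUnion.2 ⟨i, key 1 (by simp) (by rw [h, one_mul])⟩)
    · exact Or.inr (Set.mem_iUnion.2 ⟨i, key (-1) (by simp) (by rw [h]; ring)⟩)
  refine ((measure_mono hcov).trans_lt ((measure_union_le _ _).trans_lt (ENNReal.add_lt_top.2 ⟨?_, ?_⟩))).ne
  · refine (measure_iUnion_le _).trans_lt ?_
    rw [tsum_fintype]
    exact ENNReal.sum_lt_top.2 fun i _ => hfin i 1 (by simp)
  · refine (measure_iUnion_le _).trans_lt ?_
    rw [tsum_fintype]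
    exact ENNReal.sum_lt_top.2 fun i _ => hfin i (-1) (by simp)

theorem sphereMeasure_prob (d : ℕ) : IsProbabilityMeasure (sphereMeasure d) := by
  constructor
  rw [sphereMeasure, Measure.smul_apply, Measure.restrict_apply_univ, smul_eq_mul]
  exact ENNReal.inv_mul_cancel (sphere_pos d) (sphere_fin d)

theorem geg_int_zero (d : ℕ) (hd : 0 < d) (n : ℕ) (x : EuclideanSpace ℝ (Fin (d + 1))) (hx : ‖x‖ = 1) :
    ∫ y, (geg (((d : ℝ) - 1) / 2) (n + 1)).eval (inner ℝ x y) ∂(sphereMeasure d) = 0 := by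
  have := sphereMeasure_prob d
  rw [int_radial d (fun s => (geg (((d : ℝ) - 1) / 2) (n + 1)).eval s) x
    (EuclideanSpace.single (0 : Fin (d+1)) (1:ℝ)) (by simp [hx])]
  have h := int_ode d (geg (((d : ℝ) - 1) / 2) (n + 1))
  have ho := geg_ode (((d : ℝ) - 1) / 2) n
  rw [show 2 * (((d : ℝ) - 1) / 2) + 1 = d by ring] at ho
  rw [ho] at h
  simp only [eval_mul, eval_neg, eval_C] at h
  rw [integral_const_mul] at h
  refine (mul_eq_zero.1 h).resolve_left ?_
  rw [neg_eq_zero]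
  have h1 : (n : ℝ) + 1 + 2 * (((d : ℝ) - 1) / 2) = n + d := by ring
  rw [h1]
  have : (0 : ℝ) < d := by exact_mod_cast hd
  positivity

theorem exists_mv (d : ℕ) (p : ℝ[X]) (x : EuclideanSpace ℝ (Fin (d + 1))) :
    ∃ q : MvPolynomial (Fin (d + 1)) ℝ, q.totalDegree ≤ p.natDegree ∧
      ∀ y : EuclideanSpace ℝ (Fin (d + 1)), MvPolynomial.eval (fun i => y i) q = p.eval (inner ℝ x y) := by
  let ℓ : MvPolynomial (Fin (d + 1)) ℝ := ∑ i, MvPolynomial.C (x i) * MvPolynomial.X i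
  have hl : ℓ.totalDegree ≤ 1 := by
    refine MvPolynomial.totalDegree_finsetSum_le fun i _ => ?_
    refine (MvPolynomial.totalDegree_mul _ _).trans ?_
    simp
  refine ⟨∑ k ∈ Finset.range (p.natDegree + 1), MvPolynomial.C (p.coeff k) * ℓ ^ k, ?_, ?_⟩
  · refine MvPolynomial.totalDegree_finsetSum_le fun k hk => ?_
    refine (MvPolynomial.totalDegree_mul _ _).trans ?_
    rw [MvPolynomial.totalDegree_C, zero_add]
    refine (MvPolynomial.totalDegree_pow _ _).trans ?_
    have := Finset.mem_range.1 hk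
    nlinarith
  · intro y
    have hy : MvPolynomial.eval (fun i => y i) ℓ = inner ℝ x y := by
      simp only [ℓ, map_sum, map_mul, MvPolynomial.eval_C, MvPolynomial.eval_X, PiLp.inner_apply]
      refine Finset.sum_congr rfl fun i _ => ?_
      simp [mul_comm]
    rw [Polynomial.eval_eq_sum_range]
    simp only [map_sum, map_mul, map_pow, MvPolynomial.eval_C, hy]

end


/-- for a spherical `t`-design `X_N` on `S^d`, every `x ∈ S^d` and `0 ≤ r < 1`,
the Riesz `(d-1)`-potential of the equal-weight measure on `X_N` at the interior point `r·x`
satisfies `|(1/N) Σ_{y ∈ X_N} ‖r x - y‖^{-(d-1)} - 1| ≤ binom(t+d-1, d-2) r^{t+1}/(1-r)^{d-1}`. -/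
theorem design_potential_estimate (d t N : ℕ) (hd : 2 ≤ d)
    (X : Finset (EuclideanSpace ℝ (Fin (d + 1)))) (hcard : X.card = N)
    (hXsphere : ∀ x ∈ X, ‖x‖ = 1)
    (hdesign : IsSphericalDesign d t X)
    (x : EuclideanSpace ℝ (Fin (d + 1))) (hx : ‖x‖ = 1)
    (r : ℝ) (hr0 : 0 ≤ r) (hr1 : r < 1) :
    |(N : ℝ)⁻¹ * ∑ y ∈ X, (‖r • x - y‖ ^ (d - 1))⁻¹ - 1| ≤
      (Nat.choose (t + d - 1) (d - 2) : ℝ) * r ^ (t + 1) / (1 - r) ^ (d - 1) := by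
  obtain ⟨m, rfl⟩ : ∃ m, d = m + 2 := ⟨d - 2, by omega⟩
  have hprob := sphereMeasure_prob (m + 2)
  have hN : (N : ℝ) ≠ 0 := by
    intro h0
    have h := hdesign 1 (by simp)
    rw [hcard, h0] at h
    simp at h
  set l : ℝ := (((m + 2 : ℕ) : ℝ) - 1) / 2 with hl
  have hm : 2 * l = m + 1 := by rw [hl]; push_cast; ring
  have hs : ∀ y ∈ X, |inner ℝ x y| ≤ 1 := fun y hy => by
    have := abs_real_inner_le_norm x y
    rwa [hx, hXsphere y hy, one_mul] at this
  have hsum : HasSum (fun n => r ^ n * ((N : ℝ)⁻¹ * ∑ y ∈ X, (geg l n).eval (inner ℝ x y)))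
      ((N : ℝ)⁻¹ * ∑ y ∈ X, (‖r • x - y‖ ^ (m + 1))⁻¹) := by
    have h1 := (hasSum_sum (s := X) fun y hy => geg_hasSum l m hm (inner ℝ x y) (hs y hy) r hr0 hr1 ‖r • x - y‖
      (norm_nonneg _) (by
        rw [norm_sub_sq_real, norm_smul, inner_smul_left, hx, hXsphere y hy, Real.norm_of_nonneg hr0]
        simp
        ring)).mul_left ((N : ℝ)⁻¹)
    convert! h1 using 2 with n
    rw [← Finset.mul_sum]
    ring
  have key := tail_bound m t r hr0 hr1 _ _ ?_ ?_ ?_ hsum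
  · rw [show m + 2 - 1 = m + 1 by omega, show t + (m + 2) - 1 = t + 1 + m by omega,
      show m + 2 - 2 = m by omega]
    exact key
  · intro n
    rw [abs_mul, abs_inv, Nat.abs_cast, inv_mul_le_iff₀ (by positivity)]
    refine (Finset.abs_sum_le_sum_abs _ _).trans ?_
    refine (Finset.sum_le_card_nsmul _ _ _ fun y hy => geg_bound l m hm _ (hs y hy) n).trans ?_
    rw [hcard, nsmul_eq_mul]
  · simp [geg, hcard, hN]
  · intro n h1 hn
    obtain ⟨n, rfl⟩ : ∃ k, n = k + 1 := ⟨n - 1, by omega⟩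
    obtain ⟨q, hq1, hq2⟩ := exists_mv (m + 2) (geg l (n + 1)) x
    have h := hdesign q (hq1.trans ((geg_natDegree l n).2.trans hn))
    simp only [hq2, hcard] at h
    rw [h]
    exact geg_int_zero (m + 2) (by omega) n x hx
end

section
/- There exist constants c_1 > 0 and c_2 > 0 depending only on d such that for every positive integer t and every spherical t-design X_N on S^d with N points and every x ∈ S^d, the number of points of X_N lying in the spherical cap C(x, c_1/t) of angular radius c_1/t centred at x is at most c_2 · N · σ_d(C(x, c_1/t)). -/
open MeasureTheory
open scoped RealInnerProductSpace

open Polynomial in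
lemma fejer_exists (m : ℕ) (hm : 0 < m) : ∃ F : ℝ[X], F.natDegree ≤ m - 1 ∧
    (∀ u : ℝ, -1 ≤ u → u ≤ 1 → 0 ≤ F.eval u ∧ F.eval u * (m ^ 2 * (1 - u)) ≤ 2 ∧
      F.eval u ≤ Real.pi ^ 2 / 4) ∧
    ∀ θ : ℝ, 0 ≤ θ → θ * m ≤ Real.pi → 4 / Real.pi ^ 2 ≤ F.eval (Real.cos θ) := by
  have hpi := Real.pi_gt_three
  have hm' : (0:ℝ) < m := by exact_mod_cast hm
  have hm1 : (1:ℝ) ≤ m := by exact_mod_cast hm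
  set T := Chebyshev.T ℝ m with hT
  set Q := (1 - T) /ₘ (X - C 1) with hQ
  have hroot : (X - C 1) * Q = 1 - T := by
    rw [mul_divByMonic_eq_iff_isRoot]
    simp [IsRoot, hT]
  have hQ1 : Q.eval 1 = - (m:ℝ)^2 := by
    have := congrArg (fun p => (derivative p).eval 1) hroot
    simpa [hT, Chebyshev.derivative_T_eval_one] using this
  have hQd : Q.natDegree ≤ m - 1 := by
    rw [hQ, natDegree_divByMonic _ (monic_X_sub_C 1), natDegree_X_sub_C]
    apply Nat.sub_le_sub_right
    refine (natDegree_sub_le _ _).trans ?_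
    simp [hT, Chebyshev.natDegree_T]
  have hQc : ∀ θ : ℝ, (1 - Real.cos θ) * (-(Q.eval (Real.cos θ))) = 1 - Real.cos (m * θ) := by
    intro θ
    have := congrArg (fun p => p.eval (Real.cos θ)) hroot
    simp [hT] at this
    linarith
  have hpos : ∀ θ : ℝ, 0 < θ → θ ≤ Real.pi → 2 / Real.pi ^ 2 * θ ^ 2 ≤ 1 - Real.cos θ := by
    intro θ h0 h1
    have := Real.cos_le_one_sub_mul_cos_sq (x := θ) (by rw [abs_of_pos h0]; exact h1)
    linarith
  refine ⟨C (-(1 / (m:ℝ)^2)) * Q, (natDegree_C_mul_le _ _).trans hQd, ?_, ?_⟩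
  · intro u hu1 hu2
    obtain ⟨θ, h0, h1, rfl⟩ : ∃ θ : ℝ, 0 ≤ θ ∧ θ ≤ Real.pi ∧ Real.cos θ = u :=
      ⟨Real.arccos u, Real.arccos_nonneg u, Real.arccos_le_pi u, Real.cos_arccos hu1 hu2⟩
    have hE : eval (Real.cos θ) (C (-(1 / (m:ℝ)^2)) * Q) = (-(Q.eval (Real.cos θ))) / m ^ 2 := by
      simp; ring
    rw [hE]
    rcases h0.eq_or_lt with rfl | h0
    · simp [hQ1, hm'.ne']
      nlinarith
    · have hp := hpos θ h0 h1
      have hp0 : 0 < 2 / Real.pi ^ 2 * θ ^ 2 := by positivity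
      have hc := hQc θ
      set q := -(Q.eval (Real.cos θ))
      have hd : 0 < 1 - Real.cos θ := by linarith
      have hq : q = (1 - Real.cos (m * θ)) / (1 - Real.cos θ) := by
        field_simp; linarith
      have hq0 : 0 ≤ q := by
        rw [hq]; apply div_nonneg _ hd.le; linarith [Real.cos_le_one (m * θ)]
      refine ⟨by positivity, ?_, ?_⟩
      · have : q / m ^ 2 * (m ^ 2 * (1 - Real.cos θ)) = 1 - Real.cos (m * θ) := by
          rw [← hc]; field_simp
        rw [this]; linarith [Real.neg_one_le_cos (m * θ)]
      · rw [div_le_iff₀ (by positivity), hq, div_le_iff₀ hd]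
        have h2 := Real.one_sub_sq_div_two_le_cos (x := m * θ)
        calc 1 - Real.cos (m * θ) ≤ (m * θ) ^ 2 / 2 := by linarith
          _ = Real.pi ^ 2 / 4 * m ^ 2 * (2 / Real.pi ^ 2 * θ ^ 2) := by field_simp; ring
          _ ≤ _ := by gcongr
  · intro θ h0 h1
    have hE : eval (Real.cos θ) (C (-(1 / (m:ℝ)^2)) * Q) = (-(Q.eval (Real.cos θ))) / m ^ 2 := by
      simp; ring
    rw [hE]
    rcases h0.eq_or_lt with rfl | h0
    · simp [hQ1, hm'.ne']
      rw [div_le_one (by positivity)]; nlinarith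
    · have hθ : θ ≤ Real.pi := by nlinarith
      have hp := hpos θ h0 hθ
      have hp2 := hpos (m * θ) (by positivity) (by linarith)
      have hp0 : 0 < 2 / Real.pi ^ 2 * θ ^ 2 := by positivity
      have hc := hQc θ
      set q := -(Q.eval (Real.cos θ))
      have hd : 0 < 1 - Real.cos θ := by linarith
      have hq : q = (1 - Real.cos (m * θ)) / (1 - Real.cos θ) := by
        field_simp; linarith
      rw [le_div_iff₀ (by positivity), hq, le_div_iff₀ hd]
      have h2 := Real.one_sub_sq_div_two_le_cos (x := θ)
      calc 4 / Real.pi ^ 2 * m ^ 2 * (1 - Real.cos θ) ≤ 4 / Real.pi ^ 2 * m ^ 2 * (θ ^ 2 / 2) := by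
            gcongr; linarith
        _ = 2 / Real.pi ^ 2 * (m * θ) ^ 2 := by ring
        _ ≤ _ := hp2

lemma exists_zonal {n : ℕ} (x : EuclideanSpace ℝ (Fin n)) (F : Polynomial ℝ) (s : ℕ)
    (hF : F.natDegree ≤ s) : ∃ p : MvPolynomial (Fin n) ℝ, p.totalDegree ≤ s ∧
      ∀ y : EuclideanSpace ℝ (Fin n), MvPolynomial.eval (fun i => y i) p = F.eval ⟪y, x⟫ := by
  set L : MvPolynomial (Fin n) ℝ := ∑ i, MvPolynomial.C (x i) * MvPolynomial.X i with hL
  have hLd : L.totalDegree ≤ 1 := by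
    apply MvPolynomial.totalDegree_finsetSum_le
    intro i _
    refine (MvPolynomial.totalDegree_mul _ _).trans ?_
    simp
  refine ⟨Polynomial.aeval L F, ?_, ?_⟩
  · rw [Polynomial.aeval_eq_sum_range]
    apply MvPolynomial.totalDegree_finsetSum_le
    intro i hi
    refine (MvPolynomial.totalDegree_smul_le _ _).trans ((MvPolynomial.totalDegree_pow _ _).trans ?_)
    have := Finset.mem_range.1 hi
    nlinarith
  · intro y
    have h1 : MvPolynomial.eval (fun i => y i) L = ⟪y, x⟫ := by
      simp [hL, PiLp.inner_apply]
    rw [← h1, Polynomial.aeval_def, Polynomial.hom_eval₂, Polynomial.eval, Polynomial.eval₂_eq_sum, Polynomial.eval₂_eq_sum]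
    simp [MvPolynomial.algebraMap_eq]

lemma cover_const (n : ℕ) : ∃ M : ℕ, 0 < M ∧ ∀ (x : EuclideanSpace ℝ (Fin n)) (r : ℝ), 0 < r →
    ∃ S : Finset (EuclideanSpace ℝ (Fin n)), S.card ≤ M ∧
      Metric.ball x (2 * r) ⊆ ⋃ z ∈ S, Metric.ball z (r / 2) := by
  classical
  obtain ⟨t, -, ht, hc⟩ := (isCompact_closedBall (0 : EuclideanSpace ℝ (Fin n)) 2).finite_cover_balls
    (e := 1 / 2) (by norm_num)
  refine ⟨ht.toFinset.card + 1, by omega, fun x r hr => ⟨ht.toFinset.image (fun z => x + r • z),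
    Finset.card_image_le.trans (by omega), ?_⟩⟩
  intro y hy
  have hy' : r⁻¹ • (y - x) ∈ Metric.closedBall (0 : EuclideanSpace ℝ (Fin n)) 2 := by
    rw [mem_closedBall_zero_iff, norm_smul, norm_inv, Real.norm_of_nonneg hr.le]
    rw [mem_ball_iff_norm] at hy
    rw [inv_mul_le_iff₀ hr]; linarith
  obtain ⟨z, hz, hzb⟩ := Set.mem_iUnion₂.1 (hc hy')
  refine Set.mem_iUnion₂.2 ⟨x + r • z, by simp; exact ⟨z, hz, rfl⟩, ?_⟩
  rw [mem_ball_iff_norm] at hzb ⊢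
  have : y - (x + r • z) = r • (r⁻¹ • (y - x) - z) := by
    rw [smul_sub, smul_inv_smul₀ hr.ne']; abel
  rw [this, norm_smul, Real.norm_of_nonneg hr.le]
  nlinarith

lemma sphereMeasure_ball_eq (d : ℕ) (x z : EuclideanSpace ℝ (Fin (d + 1))) (hx : ‖x‖ = 1)
    (hz : ‖z‖ = 1) (r : ℝ) :
    sphereMeasure d (Metric.ball z r) = sphereMeasure d (Metric.ball x r) := by
  set e := (Submodule.reflection (Submodule.span ℝ {x - z})ᗮ) with he
  have hex : e x = z := Submodule.reflection_sub (hx.trans hz.symm)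
  simp only [sphereMeasure, Measure.smul_apply, smul_eq_mul]
  congr 1
  rw [Measure.restrict_apply Metric.isOpen_ball.measurableSet,
    Measure.restrict_apply Metric.isOpen_ball.measurableSet,
    ← e.toIsometryEquiv.hausdorffMeasure_preimage (d : ℝ) (Metric.ball z r ∩ _)]
  congr 1
  ext y
  have h2 : e.symm z = x := by rw [← hex, e.symm_apply_apply]
  simp [dist_eq_norm, h2]

lemma sphereMeasure_null (d : ℕ) (A : Set (EuclideanSpace ℝ (Fin (d + 1)))) (hA : MeasurableSet A)
    (h : ∀ y ∈ A, ‖y‖ ≠ 1) : sphereMeasure d A = 0 := by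
  simp only [sphereMeasure, Measure.smul_apply, smul_eq_mul]
  rw [Measure.restrict_apply hA]
  have : A ∩ Metric.sphere (0 : EuclideanSpace ℝ (Fin (d + 1))) 1 = ∅ := by
    ext y; simp; exact h y
  simp [this]

lemma sphereMeasure_doubling (d : ℕ) : ∃ M : ℕ, 0 < M ∧
    ∀ (x : EuclideanSpace ℝ (Fin (d + 1))) (r : ℝ), ‖x‖ = 1 → 0 < r →
      sphereMeasure d (Metric.ball x (2 * r)) ≤ M * sphereMeasure d (Metric.ball x r) := by
  obtain ⟨M, hM, h⟩ := cover_const (d + 1)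
  refine ⟨M, hM, fun x r hx hr => ?_⟩
  obtain ⟨S, hS, hc⟩ := h x r hr
  calc sphereMeasure d (Metric.ball x (2 * r))
      ≤ ∑ z ∈ S, sphereMeasure d (Metric.ball z (r / 2)) :=
        (measure_mono hc).trans (measure_biUnion_finset_le _ _)
    _ ≤ ∑ z ∈ S, sphereMeasure d (Metric.ball x r) := by
        apply Finset.sum_le_sum
        intro z _
        by_cases hw : ∃ w ∈ Metric.ball z (r / 2), ‖w‖ = 1
        · obtain ⟨w, hwz, hw1⟩ := hw
          rw [← sphereMeasure_ball_eq d x w hx hw1]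
          apply measure_mono
          apply Metric.ball_subset_ball'
          rw [Metric.mem_ball, dist_comm] at hwz
          linarith
        · push Not at hw
          rw [sphereMeasure_null d _ Metric.isOpen_ball.measurableSet hw]
          exact zero_le
    _ = S.card * sphereMeasure d (Metric.ball x r) := by simp
    _ ≤ _ := by gcongr

lemma doubling_iter (d M : ℕ)
    (h : ∀ (x : EuclideanSpace ℝ (Fin (d + 1))) (r : ℝ), ‖x‖ = 1 → 0 < r →
      sphereMeasure d (Metric.ball x (2 * r)) ≤ M * sphereMeasure d (Metric.ball x r))
    (x : EuclideanSpace ℝ (Fin (d + 1))) (r : ℝ) (hx : ‖x‖ = 1) (hr : 0 < r) (j : ℕ) :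
    sphereMeasure d (Metric.ball x (2 ^ j * r)) ≤ M ^ j * sphereMeasure d (Metric.ball x r) := by
  induction j with
  | zero => simp
  | succ j ih =>
    calc _ = sphereMeasure d (Metric.ball x (2 * (2 ^ j * r))) := by ring_nf
      _ ≤ M * sphereMeasure d (Metric.ball x (2 ^ j * r)) := h x _ hx (by positivity)
      _ ≤ M * (M ^ j * sphereMeasure d (Metric.ball x r)) := by gcongr
      _ = _ := by ring

/-- Integral bound for a function with dyadic decay away from `x`. -/
lemma lintegral_decay (d M : ℕ) (hM : 0 < M)
    (h : ∀ (x : EuclideanSpace ℝ (Fin (d + 1))) (r : ℝ), ‖x‖ = 1 → 0 < r →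
      sphereMeasure d (Metric.ball x (2 * r)) ≤ M * sphereMeasure d (Metric.ball x r))
    (x : EuclideanSpace ℝ (Fin (d + 1))) (r : ℝ) (hx : ‖x‖ = 1) (hr : 0 < r)
    (f : EuclideanSpace ℝ (Fin (d + 1)) → ℝ) (K : ℝ) (hK : 0 ≤ K)
    (hf0 : ∀ y, ‖y‖ = 1 → f y ≤ K)
    (hf : ∀ y (j : ℕ), ‖y‖ = 1 → 2 ^ j * r ≤ ‖y - x‖ → f y ≤ K * (1 / (2 * M)) ^ (j + 1)) :
    ∫⁻ y, ENNReal.ofReal (f y) ∂(sphereMeasure d) ≤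
      ENNReal.ofReal (K * 2) * sphereMeasure d (Metric.ball x r) := by
  set a : ℝ := 1 / (2 * M) with ha
  have hM' : (0:ℝ) < M := by exact_mod_cast hM
  have ha0 : 0 < a := by positivity
  have hae : ∀ᵐ y ∂(sphereMeasure d), ‖y‖ = 1 := by
    have : MeasurableSet {y : EuclideanSpace ℝ (Fin (d + 1)) | ‖y‖ = 1} :=
      (isClosed_eq continuous_norm continuous_const).measurableSet
    rw [ae_iff]
    exact sphereMeasure_null d _ this.compl (fun y hy => hy)
  have hpt : ∀ᵐ y ∂(sphereMeasure d), ENNReal.ofReal (f y) ≤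
      ∑' j : ℕ, (Metric.ball x (2 ^ j * r)).indicator (fun _ => ENNReal.ofReal (K * a ^ j)) y := by
    filter_upwards [hae] with y hy
    have hex : ∃ j : ℕ, ‖y - x‖ < 2 ^ j * r := by
      obtain ⟨j, hj⟩ := pow_unbounded_of_one_lt (‖y - x‖ / r) (by norm_num : (1:ℝ) < 2)
      exact ⟨j, by rwa [div_lt_iff₀ hr] at hj⟩
    classical
    have hj := Nat.find_spec hex
    have hmin := fun i => Nat.find_min hex (m := i)
    set j := Nat.find hex
    refine le_trans ?_ (ENNReal.le_tsum j)
    rw [Set.indicator_of_mem (by rwa [mem_ball_iff_norm])]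
    apply ENNReal.ofReal_le_ofReal
    rcases Nat.eq_zero_or_pos j with h0 | h0
    · rw [h0]; simpa using hf0 y hy
    · obtain ⟨i, hi⟩ := Nat.exists_eq_succ_of_ne_zero h0.ne'
      have := hmin i (by omega)
      rw [hi]
      exact hf y i hy (not_lt.1 this)
  calc _ ≤ ∫⁻ y, ∑' j : ℕ, (Metric.ball x (2 ^ j * r)).indicator
        (fun _ => ENNReal.ofReal (K * a ^ j)) y ∂(sphereMeasure d) := lintegral_mono_ae hpt
    _ = ∑' j : ℕ, ENNReal.ofReal (K * a ^ j) * sphereMeasure d (Metric.ball x (2 ^ j * r)) := by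
        rw [lintegral_tsum]
        · congr 1; ext j
          rw [lintegral_indicator_const Metric.isOpen_ball.measurableSet]
        · intro j
          exact (measurable_const.indicator Metric.isOpen_ball.measurableSet).aemeasurable
    _ ≤ ∑' j : ℕ, ENNReal.ofReal K * sphereMeasure d (Metric.ball x r) * (2⁻¹ : ENNReal) ^ j := by
        apply ENNReal.tsum_le_tsum
        intro j
        calc _ ≤ ENNReal.ofReal (K * a ^ j) * (M ^ j * sphereMeasure d (Metric.ball x r)) := by
              gcongr; exact doubling_iter d M h x r hx hr j
          _ = ENNReal.ofReal K * sphereMeasure d (Metric.ball x r) *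
              (ENNReal.ofReal (a ^ j) * M ^ j) := by
              rw [ENNReal.ofReal_mul hK]; ring
          _ = _ := by
              congr 1
              rw [ENNReal.ofReal_pow ha0.le, ← mul_pow, ← ENNReal.ofReal_natCast M,
                ← ENNReal.ofReal_mul ha0.le]
              congr 1
              have : a * M = 2⁻¹ := by rw [ha]; field_simp
              rw [this, ENNReal.ofReal_inv_of_pos (by norm_num)]; simp
    _ = _ := by
        rw [ENNReal.tsum_mul_left, ENNReal.tsum_geometric, ENNReal.one_sub_inv_two, inv_inv,
          ENNReal.ofReal_mul hK]
        simp; ring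

open scoped Classical in
/-- Reimer: there are constants `c₁, c₂ > 0` depending only on `d` such that
for every `t ≥ 1`, every spherical `t`-design `X_N` on `S^d` and every `x ∈ S^d`, the number
of points of `X_N` in the cap `C(x, c₁/t)` is at most `c₂ N σ_d(C(x, c₁/t))`. -/
theorem design_coarse_equidistribution (d : ℕ) (hd : 1 ≤ d) :
    ∃ c₁ c₂ : ℝ, 0 < c₁ ∧ 0 < c₂ ∧ ∀ t N : ℕ, 0 < t →
      ∀ X : Finset (EuclideanSpace ℝ (Fin (d + 1))), X.card = N →
        (∀ x ∈ X, ‖x‖ = 1) → IsSphericalDesign d t X →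
        ∀ x : EuclideanSpace ℝ (Fin (d + 1)), ‖x‖ = 1 →
          ((X.filter fun y => Real.cos (c₁ / t) < ⟪y, x⟫).card : ℝ) ≤
            c₂ * N * (sphereMeasure d {y | Real.cos (c₁ / t) < ⟪y, x⟫}).toReal := by
  obtain ⟨k, hk, hdoub⟩ := sphereMeasure_doubling d
  have hpi := Real.pi_gt_three
  have hpi4 := Real.pi_le_four
  have hk' : (1:ℝ) ≤ k := by exact_mod_cast hk
  set K : ℝ := (64 * k ^ 2) ^ k with hK
  have hKpos : 0 < K := by positivity
  set b : ℝ := (4 / Real.pi ^ 2) ^ k with hb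
  have hbpos : 0 < b := by positivity
  refine ⟨1, K * 2 / b, one_pos, by positivity, ?_⟩
  intro t N ht X hN hX hdes x hx
  rcases Nat.eq_zero_or_pos N with h0 | hNpos
  · have : X = ∅ := by rw [← Finset.card_eq_zero, hN, h0]
    simp [this, h0]
  have hN' : (0:ℝ) < N := by exact_mod_cast hNpos
  have ht' : (1:ℝ) ≤ t := by exact_mod_cast ht
  -- the measure is finite
  have hfin : sphereMeasure d Set.univ ≠ ⊤ := by
    have h1 := hdes 1 (by simp)
    simp only [map_one, Finset.sum_const, nsmul_eq_mul, mul_one, integral_const, smul_eq_mul] at h1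
    rw [hN, inv_mul_cancel₀ hN'.ne'] at h1
    intro h
    simp [Measure.real, h] at h1
  have hfinA : ∀ A, sphereMeasure d A ≠ ⊤ := fun A =>
    ne_top_of_le_ne_top hfin (measure_mono (Set.subset_univ A))
  set m := t / k + 1 with hm
  have hmpos : 0 < m := Nat.succ_pos _
  have hmk : t < m * k := by
    rw [hm]; have := Nat.div_add_mod t k; have := Nat.mod_lt t hk; nlinarith
  have hmk2 : k * (m - 1) ≤ t := by
    rw [hm]; simpa using Nat.mul_div_le t k
  have hm2 : m ≤ 2 * t := by
    have := Nat.div_le_self t k; omega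
  have hmkR : (t:ℝ) ≤ m * k := by exact_mod_cast hmk.le
  have hm2R : (m:ℝ) ≤ 2 * t := by exact_mod_cast hm2
  have hmR : (0:ℝ) < m := by exact_mod_cast hmpos
  obtain ⟨F, hFd, hF1, hF2⟩ := fejer_exists m hmpos
  obtain ⟨p, hpd, hp⟩ := exists_zonal x (F ^ k) t
    ((Polynomial.natDegree_pow_le.trans (Nat.mul_le_mul_left k hFd)).trans hmk2)
  simp only [Polynomial.eval_pow] at hp
  have hdesp := hdes p hpd
  rw [hN] at hdesp
  have hinner : ∀ y : EuclideanSpace ℝ (Fin (d + 1)), ‖y‖ = 1 → -1 ≤ ⟪y, x⟫ ∧ ⟪y, x⟫ ≤ 1 := by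
    intro y hy
    have := abs_real_inner_le_norm y x
    rw [hy, hx, one_mul] at this
    exact abs_le.1 this
  have hdist : ∀ y : EuclideanSpace ℝ (Fin (d + 1)), ‖y‖ = 1 → ‖y - x‖ ^ 2 = 2 * (1 - ⟪y, x⟫) := by
    intro y hy
    rw [norm_sub_sq_real, hy, hx]; ring
  set r : ℝ := 1 / (2 * t) with hr
  have hrpos : 0 < r := by positivity
  set f : EuclideanSpace ℝ (Fin (d + 1)) → ℝ := fun y => (F.eval ⟪y, x⟫) ^ k with hf
  have hf0 : ∀ y, ‖y‖ = 1 → 0 ≤ f y := fun y hy =>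
    pow_nonneg (hF1 _ (hinner y hy).1 (hinner y hy).2).1 k
  -- integral bound
  have hlint := lintegral_decay d k hk hdoub x r hx hrpos f K hKpos.le
    (by
      intro y hy
      obtain ⟨h1, h2, h3⟩ := hF1 _ (hinner y hy).1 (hinner y hy).2
      apply pow_le_pow_left₀ h1
      nlinarith)
    (by
      intro y j hy hyj
      obtain ⟨h1, h2, h3⟩ := hF1 _ (hinner y hy).1 (hinner y hy).2
      have hD := hdist y hy
      have hsq : (2 ^ j * r) ^ 2 ≤ 2 * (1 - ⟪y, x⟫) := by
        rw [← hD]; gcongr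
      have hFle : F.eval ⟪y, x⟫ ≤ 64 * k ^ 2 * (1 / 4) ^ (j + 1) := by
        have e1 : (0:ℝ) < (2 ^ j / (4 * k)) ^ 2 := by positivity
        have e2 : ((2:ℝ) ^ j / (2 * k)) ^ 2 ≤ m ^ 2 * (2 * (1 - ⟪y, x⟫)) := by
          calc ((2:ℝ) ^ j / (2 * k)) ^ 2 ≤ (m * (2 ^ j * r)) ^ 2 := by
                gcongr
                rw [hr, div_le_iff₀ (by positivity)]
                have : (m:ℝ) * (2 ^ j * (1 / (2 * t))) * (2 * k) = 2 ^ j * (m * k / t) := by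
                  field_simp
                rw [this]
                apply le_mul_of_one_le_right (by positivity)
                rw [one_le_div (by positivity)]; exact hmkR
            _ = m ^ 2 * (2 ^ j * r) ^ 2 := by ring
            _ ≤ _ := by gcongr
        have e3 : F.eval ⟪y, x⟫ * ((2:ℝ) ^ j / (2 * k)) ^ 2 ≤ 4 := by
          calc _ ≤ F.eval ⟪y, x⟫ * (m ^ 2 * (2 * (1 - ⟪y, x⟫))) := by gcongr
            _ = 2 * (F.eval ⟪y, x⟫ * (m ^ 2 * (1 - ⟪y, x⟫))) := by ring
            _ ≤ _ := by linarith
        rw [← le_div_iff₀ (by positivity)] at e3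
        refine e3.trans (le_of_eq ?_)
        have : ((2:ℝ) ^ j) ^ 2 = 4 ^ j := by rw [← pow_mul, mul_comm, pow_mul]; norm_num
        rw [div_pow, this, pow_succ, one_div_pow]
        field_simp
        ring
      have h4k : ((1:ℝ) / 4) ^ k ≤ 1 / (2 * k) := by
        rw [one_div_pow]
        apply one_div_le_one_div_of_le (by positivity)
        have : (2:ℝ) * k ≤ 4 ^ k := by
          have hb := one_add_mul_le_pow (by norm_num : (-2:ℝ) ≤ 3) k
          norm_num at hb
          linarith
        exact this
      calc f y ≤ (64 * k ^ 2 * (1 / 4) ^ (j + 1)) ^ k := pow_le_pow_left₀ h1 hFle k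
        _ = K * ((1 / 4) ^ k) ^ (j + 1) := by
            rw [mul_pow, ← pow_mul, ← pow_mul, mul_comm (j + 1) k]
        _ ≤ _ := by gcongr)
  have hcont : Continuous f := by
    have : Continuous fun y : EuclideanSpace ℝ (Fin (d + 1)) => F.eval ⟪y, x⟫ :=
      F.continuous.comp (by fun_prop)
    exact this.pow k
  have hae : ∀ᵐ y ∂(sphereMeasure d), 0 ≤ f y := by
    have : MeasurableSet {y | 0 ≤ f y} := (isClosed_le continuous_const hcont).measurableSet
    rw [ae_iff]
    exact sphereMeasure_null d _ this.compl (fun y hy h1 => hy (hf0 y h1))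
  have hIntegral : ∫ y, f y ∂(sphereMeasure d) ≤ K * 2 * (sphereMeasure d (Metric.ball x r)).toReal := by
    rw [integral_eq_lintegral_of_nonneg_ae hae hcont.aestronglyMeasurable]
    have := ENNReal.toReal_mono (ENNReal.mul_ne_top ENNReal.ofReal_ne_top (hfinA _)) hlint
    rwa [ENNReal.toReal_mul, ENNReal.toReal_ofReal (by positivity)] at this
  -- ball inside cap, up to a null set
  have hcap : sphereMeasure d (Metric.ball x r) ≤
      sphereMeasure d {y | Real.cos (1 / t) < ⟪y, x⟫} := by
    apply measure_mono_ae
    have hs : ∀ᵐ y ∂(sphereMeasure d), ‖y‖ = 1 := by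
      have : MeasurableSet {y : EuclideanSpace ℝ (Fin (d + 1)) | ‖y‖ = 1} :=
        (isClosed_eq continuous_norm continuous_const).measurableSet
      rw [ae_iff]
      exact sphereMeasure_null d _ this.compl (fun y hy => hy)
    filter_upwards [hs] with y hy hyb
    have hyb' : ‖y - x‖ < r := by rwa [← mem_ball_iff_norm]
    have hD := hdist y hy
    have h1 : ‖y - x‖ ^ 2 < r ^ 2 := by gcongr
    have ht1 : (1:ℝ) / t ≤ 1 := by rw [div_le_one (by positivity)]; exact ht'
    have h2 := Real.cos_le_one_sub_mul_cos_sq (x := 1 / (t:ℝ))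
      (by rw [abs_of_pos (by positivity)]; linarith)
    have h3 : r ^ 2 = (1 / (t:ℝ)) ^ 2 / 4 := by rw [hr]; field_simp; norm_num
    have h4 : 1 / 8 ≤ 2 / Real.pi ^ 2 := by
      rw [div_le_div_iff₀ (by norm_num) (by positivity)]; nlinarith
    have h5 : 1 / 8 * (1 / (t:ℝ)) ^ 2 ≤ 2 / Real.pi ^ 2 * (1 / (t:ℝ)) ^ 2 := by gcongr
    change Real.cos (1 / t) < ⟪y, x⟫
    linarith
  have hcap' : (sphereMeasure d (Metric.ball x r)).toReal ≤
      (sphereMeasure d {y | Real.cos (1 / t) < ⟪y, x⟫}).toReal :=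
    ENNReal.toReal_mono (hfinA _) hcap
  -- lower bound of the sum
  have hsum : ((X.filter fun y => Real.cos (1 / t) < ⟪y, x⟫).card : ℝ) * b ≤ ∑ y ∈ X, f y := by
    calc _ = ∑ y ∈ X.filter (fun y => Real.cos (1 / t) < ⟪y, x⟫), b := by simp
      _ ≤ ∑ y ∈ X.filter (fun y => Real.cos (1 / t) < ⟪y, x⟫), f y := by
          apply Finset.sum_le_sum
          intro y hy
          obtain ⟨hyX, hyc⟩ := Finset.mem_filter.1 hy
          obtain ⟨i1, i2⟩ := hinner y (hX y hyX)
          apply pow_le_pow_left₀ (by positivity)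
          have hc := Real.cos_arccos i1 i2
          rw [← hc]
          apply hF2 _ (Real.arccos_nonneg _)
          have ha : Real.arccos ⟪y, x⟫ ≤ 1 / t := by
            by_contra hcon
            push Not at hcon
            have := Real.cos_le_cos_of_nonneg_of_le_pi (by positivity) (Real.arccos_le_pi _) hcon.le
            linarith
          calc Real.arccos ⟪y, x⟫ * m ≤ 1 / t * (2 * t) := by gcongr
            _ = 2 := by field_simp
            _ ≤ _ := by linarith
      _ ≤ _ := by
          apply Finset.sum_le_sum_of_subset_of_nonneg (Finset.filter_subset _ _)
          intro y hy _
          exact hf0 y (hX y hy)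
  have hsum2 : ∑ y ∈ X, f y = N * ∫ y, f y ∂(sphereMeasure d) := by
    simp only [hp] at hdesp
    change ∑ y ∈ X, (F.eval ⟪y, x⟫) ^ k = N * ∫ y, (F.eval ⟪y, x⟫) ^ k ∂(sphereMeasure d)
    rw [← hdesp, mul_inv_cancel_left₀ hN'.ne']
  have : K * 2 / b * N * (sphereMeasure d {y | Real.cos (1 / t) < ⟪y, x⟫}).toReal =
      (N * (K * 2 * (sphereMeasure d {y | Real.cos (1 / t) < ⟪y, x⟫}).toReal)) / b := by ring
  rw [this, le_div_iff₀ hbpos]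
  refine hsum.trans ?_
  rw [hsum2]
  gcongr
  exact hIntegral.trans (by gcongr)
end
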